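/- arXiv:2201.12996 — 10 statements merged into one kernel-verified Lean document; each statement's English description precedes it below -/
import Mathlib

section
/- Let K be an algebraically closed field of characteristic p ≥ 3 and r, s, t ∈ K, and let F = x⁴ + y⁴ + z⁴ + r·x²y² + s·y²z² + t·z²x². The projective plane quartic F = 0 is nonsingular — i.e. there is no (x, y, z) ∈ K³ with (x, y, z) ≠ (0, 0, 0) at which F and all three partial derivatives ∂F/∂x, ∂F/∂y, ∂F/∂z vanish simultaneously — if and only if r ≠ ±2, s ≠ ±2, t ≠ ±2 and r² + s² + t² − rst − 4 ≠ 0. -/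
/-- A Ciani quartic `x⁴ + y⁴ + z⁴ + r x²y² + s y²z² + t z²x² = 0` over an
algebraically closed field of characteristic `p ≥ 3` is nonsingular iff
`r, s, t ≠ ±2` and `r² + s² + t² − rst − 4 ≠ 0`. -/
theorem ciani_nonsingular_iff (K : Type*) [Field K] [IsAlgClosed K]
    (p : ℕ) [Fact p.Prime] [CharP K p] (hp : 3 ≤ p) (r s t : K) :
    (¬ ∃ x y z : K, (x, y, z) ≠ (0, 0, 0) ∧
        x ^ 4 + y ^ 4 + z ^ 4 + r * x ^ 2 * y ^ 2 + s * y ^ 2 * z ^ 2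
          + t * z ^ 2 * x ^ 2 = 0 ∧
        2 * x * (2 * x ^ 2 + r * y ^ 2 + t * z ^ 2) = 0 ∧
        2 * y * (2 * y ^ 2 + r * x ^ 2 + s * z ^ 2) = 0 ∧
        2 * z * (2 * z ^ 2 + s * y ^ 2 + t * x ^ 2) = 0) ↔
      (r ≠ 2 ∧ r ≠ -2 ∧ s ≠ 2 ∧ s ≠ -2 ∧ t ≠ 2 ∧ t ≠ -2 ∧
        r ^ 2 + s ^ 2 + t ^ 2 - r * s * t - 4 ≠ 0) := by
  have h2 : (2 : K) ≠ 0 := by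
    intro h
    have h' : ((2 : ℕ) : K) = 0 := by exact_mod_cast h
    have := Nat.le_of_dvd (by norm_num) ((CharP.cast_eq_zero_iff K p 2).1 h')
    omega
  -- two-variable case: a nonzero kernel vector forces the parameter to be 2 or -2
  have key : ∀ u a b : K, u ≠ 2 → u ≠ -2 → a ≠ 0 → 2 * a + u * b = 0 →
      2 * b + u * a = 0 → False := by
    intro u a b hu hu' ha e1 e2
    have : (u - 2) * (u + 2) * a = 0 := by linear_combination u * e2 - 2 * e1
    rcases mul_eq_zero.1 this with h | h
    · rcases mul_eq_zero.1 h with h | h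
      · exact hu (sub_eq_zero.1 h)
      · exact hu' (eq_neg_of_add_eq_zero_left h)
    · exact ha h
  obtain ⟨i, hi⟩ := IsAlgClosed.exists_pow_nat_eq (-1 : K) (n := 2) (by norm_num)
  have hi4 : i ^ 4 = 1 := by linear_combination (i ^ 2 - 1) * hi
  constructor
  · intro hns
    have hs : s ≠ 2 := by
      rintro rfl
      exact hns ⟨0, 1, i, by simp, by linear_combination hi4 + 2 * hi, by ring,
        by linear_combination 4 * hi, by linear_combination 4 * i * hi⟩
    have hs' : s ≠ -2 := by
      rintro rfl
      exact hns ⟨0, 1, 1, by simp, by ring, by ring, by ring, by ring⟩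
    refine ⟨?_, ?_, hs, hs', ?_, ?_, ?_⟩
    · rintro rfl
      exact hns ⟨1, i, 0, by simp, by linear_combination hi4 + 2 * hi,
        by linear_combination 4 * hi, by linear_combination 4 * i * hi, by ring⟩
    · rintro rfl
      exact hns ⟨1, 1, 0, by simp, by ring, by ring, by ring, by ring⟩
    · rintro rfl
      exact hns ⟨1, 0, i, by simp, by linear_combination hi4 + 2 * hi,
        by linear_combination 4 * hi, by ring, by linear_combination 4 * i * hi⟩
    · rintro rfl
      exact hns ⟨1, 0, 1, by simp, by ring, by ring, by ring, by ring⟩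
    · intro hD
      obtain ⟨x, hx⟩ := IsAlgClosed.exists_pow_nat_eq (4 - s ^ 2) (n := 2) (by norm_num)
      obtain ⟨y, hy⟩ := IsAlgClosed.exists_pow_nat_eq (s * t - 2 * r) (n := 2) (by norm_num)
      obtain ⟨z, hz⟩ := IsAlgClosed.exists_pow_nat_eq (r * s - 2 * t) (n := 2) (by norm_num)
      refine hns ⟨x, y, z, ?_, ?_, ?_, ?_, ?_⟩
      · intro h
        have hx0 : x = 0 := congrArg Prod.fst h
        have : (s - 2) * (s + 2) = 0 := by
          rw [hx0] at hx
          linear_combination hx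
        rcases mul_eq_zero.1 this with h | h
        · exact hs (sub_eq_zero.1 h)
        · exact hs' (eq_neg_of_add_eq_zero_left h)
      · have e : ∀ w : K, w ^ 4 = (w ^ 2) ^ 2 := fun w => by ring
        rw [e x, e y, e z, hx, hy, hz]
        linear_combination (-(4 - s ^ 2)) * hD
      · rw [hx, hy, hz]
        linear_combination (-4 * x) * hD
      · rw [hx, hy, hz]
        ring
      · rw [hx, hy, hz]
        ring
  · rintro ⟨hr, hr', hs, hs', ht, ht', hD⟩ ⟨x, y, z, hne, -, e1, e2, e3⟩
    have c : ∀ w v : K, w ≠ 0 → 2 * w * v = 0 → v = 0 := fun w v hw h =>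
      (mul_eq_zero.1 h).resolve_left (mul_ne_zero h2 hw)
    by_cases hx : x = 0
    · subst hx
      by_cases hy : y = 0
      · subst hy
        by_cases hz : z = 0
        · exact hne (by rw [hz])
        · have := c _ _ hz e3
          exact key s (z ^ 2) 0 hs hs' (pow_ne_zero 2 hz) (by linear_combination this)
            (by
              have : z ^ 2 = 0 := (mul_eq_zero.1 (show 2 * z ^ 2 = 0 by
                linear_combination this)).resolve_left h2
              rw [this]; ring)
      · have f2 := c _ _ hy e2
        by_cases hz : z = 0
        · subst hz
          exact mul_ne_zero h2 (pow_ne_zero 2 hy) (by linear_combination f2)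
        · have f3 := c _ _ hz e3
          exact key s (y ^ 2) (z ^ 2) hs hs' (pow_ne_zero 2 hy)
            (by linear_combination f2) (by linear_combination f3)
    · have f1 := c _ _ hx e1
      have hx2 := pow_ne_zero 2 hx
      by_cases hy : y = 0
      · subst hy
        by_cases hz : z = 0
        · subst hz
          exact mul_ne_zero h2 hx2 (by linear_combination f1)
        · have f3 := c _ _ hz e3
          exact key t (x ^ 2) (z ^ 2) ht ht' hx2
            (by linear_combination f1) (by linear_combination f3)
      · have f2 := c _ _ hy e2
        by_cases hz : z = 0
        · subst hz
          exact key r (x ^ 2) (y ^ 2) hr hr' hx2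
            (by linear_combination f1) (by linear_combination f2)
        · have f3 := c _ _ hz e3
          refine mul_ne_zero (mul_ne_zero h2 hD) hx2 ?_
          linear_combination (-(4 - s ^ 2)) * f1 - (s * t - 2 * r) * f2 - (r * s - 2 * t) * f3
end

section
/- Let K be a field of characteristic p ≥ 3 and r, s, t ∈ K with r² ≠ 4, s² ≠ 4, t² ≠ 4, rt − 2s ≠ 0 and sr − 2t ≠ 0. Fix α, β, γ ∈ K with α² = r² − 4, β² = s² − 4, γ² = t² − 4, assume (rt − 2s) + γα ≠ 0, (sr − 2t) + αβ ≠ 0, (ts − 2r) + βγ ≠ 0, and define λ₁ = ((rt−2s) − γα)/((rt−2s) + γα), λ₂ = ((sr−2t) − αβ)/((sr−2t) + αβ), λ₃ = ((ts−2r) − βγ)/((ts−2r) + βγ). Then (1+λ₁)(1+λ₂)(1−λ₃) ≠ 0 and 1 + ((1−λ₁)(1−λ₂)(1+λ₃))/((1+λ₁)(1+λ₂)(1−λ₃)) = −2r·(r² + s² + t² − rst − 4)/((rt − 2s)(sr − 2t)). -/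
/-- Identity (3.4) of the paper for the Legendre parameters of the three
quotient elliptic curves of a Ciani curve. -/
theorem ciani_identity_3_4 (K : Type*) [Field K]
    (p : ℕ) [Fact p.Prime] [CharP K p] (hp : 3 ≤ p)
    (r s t α β γ l1 l2 l3 : K)
    (hr : r ^ 2 ≠ 4) (hs : s ^ 2 ≠ 4) (ht : t ^ 2 ≠ 4)
    (h1 : r * t - 2 * s ≠ 0) (h2 : s * r - 2 * t ≠ 0)
    (hα : α ^ 2 = r ^ 2 - 4) (hβ : β ^ 2 = s ^ 2 - 4) (hγ : γ ^ 2 = t ^ 2 - 4)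
    (hd1 : (r * t - 2 * s) + γ * α ≠ 0)
    (hd2 : (s * r - 2 * t) + α * β ≠ 0)
    (hd3 : (t * s - 2 * r) + β * γ ≠ 0)
    (hl1 : l1 = ((r * t - 2 * s) - γ * α) / ((r * t - 2 * s) + γ * α))
    (hl2 : l2 = ((s * r - 2 * t) - α * β) / ((s * r - 2 * t) + α * β))
    (hl3 : l3 = ((t * s - 2 * r) - β * γ) / ((t * s - 2 * r) + β * γ)) :
    (1 + l1) * (1 + l2) * (1 - l3) ≠ 0 ∧
      1 + ((1 - l1) * (1 - l2) * (1 + l3)) / ((1 + l1) * (1 + l2) * (1 - l3)) =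
        -2 * r * (r ^ 2 + s ^ 2 + t ^ 2 - r * s * t - 4) /
          ((r * t - 2 * s) * (s * r - 2 * t)) := by
  have two : (2 : K) ≠ 0 := by
    intro h
    have h' : ((2 : ℕ) : K) = 0 := by exact_mod_cast h
    rw [CharP.cast_eq_zero_iff K p] at h'
    have := Nat.le_of_dvd (by norm_num) h'
    omega
  have hβ0 : β ≠ 0 := by
    rintro rfl
    exact hs (by linear_combination -hβ)
  have hγ0 : γ ≠ 0 := by
    rintro rfl
    exact ht (by linear_combination -hγ)
  have e1 : 1 + l1 = 2 * (r * t - 2 * s) / ((r * t - 2 * s) + γ * α) := by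
    rw [hl1, eq_div_iff hd1, add_mul, div_mul_cancel₀ _ hd1]; ring
  have f1 : 1 - l1 = 2 * (γ * α) / ((r * t - 2 * s) + γ * α) := by
    rw [hl1, eq_div_iff hd1, sub_mul, div_mul_cancel₀ _ hd1]; ring
  have e2 : 1 + l2 = 2 * (s * r - 2 * t) / ((s * r - 2 * t) + α * β) := by
    rw [hl2, eq_div_iff hd2, add_mul, div_mul_cancel₀ _ hd2]; ring
  have f2 : 1 - l2 = 2 * (α * β) / ((s * r - 2 * t) + α * β) := by
    rw [hl2, eq_div_iff hd2, sub_mul, div_mul_cancel₀ _ hd2]; ring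
  have e3 : 1 + l3 = 2 * (t * s - 2 * r) / ((t * s - 2 * r) + β * γ) := by
    rw [hl3, eq_div_iff hd3, add_mul, div_mul_cancel₀ _ hd3]; ring
  have f3 : 1 - l3 = 2 * (β * γ) / ((t * s - 2 * r) + β * γ) := by
    rw [hl3, eq_div_iff hd3, sub_mul, div_mul_cancel₀ _ hd3]; ring
  have hne : (1 + l1) * (1 + l2) * (1 - l3) ≠ 0 := by
    rw [e1, e2, f3]
    exact mul_ne_zero (mul_ne_zero (div_ne_zero (mul_ne_zero two h1) hd1)
      (div_ne_zero (mul_ne_zero two h2) hd2))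
      (div_ne_zero (mul_ne_zero two (mul_ne_zero hβ0 hγ0)) hd3)
  refine ⟨hne, ?_⟩
  have key : ((1 - l1) * (1 - l2) * (1 + l3)) / ((1 + l1) * (1 + l2) * (1 - l3)) =
      α ^ 2 * (t * s - 2 * r) / ((r * t - 2 * s) * (s * r - 2 * t)) := by
    rw [div_eq_div_iff hne (mul_ne_zero h1 h2), e1, e2, e3, f1, f2, f3]
    generalize (r * t - 2 * s) + γ * α = D1
    generalize (s * r - 2 * t) + α * β = D2
    generalize (t * s - 2 * r) + β * γ = D3
    ring
  rw [key, hα, eq_div_iff (mul_ne_zero h1 h2), add_mul,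
    div_mul_cancel₀ _ (mul_ne_zero h1 h2)]
  ring
end

section
/- Let K be a field of characteristic p ≥ 3 and r, s, t ∈ K. Fix α, β, γ ∈ K with α² = r² − 4, β² = s² − 4, γ² = t² − 4, assume (rt − 2s) + γα ≠ 0, (sr − 2t) + αβ ≠ 0, (ts − 2r) + βγ ≠ 0, rt − 2s ≠ 0, sr − 2t ≠ 0, ts − 2r ≠ 0, and define λ₁ = ((rt−2s) − γα)/((rt−2s) + γα), λ₂ = ((sr−2t) − αβ)/((sr−2t) + αβ), λ₃ = ((ts−2r) − βγ)/((ts−2r) + βγ). Then λ₁/(1+λ₁)² = (r² + s² + t² − rst − 4)/(rt − 2s)², λ₂/(1+λ₂)² = (r² + s² + t² − rst − 4)/(sr − 2t)², and λ₃/(1+λ₃)² = (r² + s² + t² − rst − 4)/(ts − 2r)². -/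
/-- The common computation: `λ = (A - B)/(A + B)` has `λ/(1+λ)² = (A² - B²)/(4A²)`. -/
theorem ciani_aux {K : Type*} [Field K] (h2 : (2 : K) ≠ 0) (A B N : K)
    (hA : A ≠ 0) (hAB : A + B ≠ 0) (h : A ^ 2 - B ^ 2 = 4 * N) :
    ((A - B) / (A + B)) / (1 + (A - B) / (A + B)) ^ 2 = N / A ^ 2 := by
  have e : 1 + (A - B) / (A + B) = 2 * A / (A + B) := by
    field_simp
    ring
  have h4 : (2 * A) ^ 2 ≠ 0 := pow_ne_zero 2 (mul_ne_zero h2 hA)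
  have e2 : ((A - B) / (A + B)) / (2 * A / (A + B)) ^ 2 = (A ^ 2 - B ^ 2) / (2 * A) ^ 2 := by
    field_simp
    ring
  rw [e, e2, div_eq_div_iff h4 (pow_ne_zero 2 hA), h]
  ring

/-- The identities `λᵢ/(1+λᵢ)² = (r²+s²+t²−rst−4)/(denominator)²` for the
Legendre parameters of the three quotient elliptic curves of a Ciani curve. -/
theorem ciani_lambda_over_one_add_sq (K : Type*) [Field K]
    (p : ℕ) [Fact p.Prime] [CharP K p] (hp : 3 ≤ p)
    (r s t α β γ l1 l2 l3 : K)
    (hα : α ^ 2 = r ^ 2 - 4) (hβ : β ^ 2 = s ^ 2 - 4) (hγ : γ ^ 2 = t ^ 2 - 4)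
    (hd1 : (r * t - 2 * s) + γ * α ≠ 0)
    (hd2 : (s * r - 2 * t) + α * β ≠ 0)
    (hd3 : (t * s - 2 * r) + β * γ ≠ 0)
    (h1 : r * t - 2 * s ≠ 0) (h2 : s * r - 2 * t ≠ 0) (h3 : t * s - 2 * r ≠ 0)
    (hl1 : l1 = ((r * t - 2 * s) - γ * α) / ((r * t - 2 * s) + γ * α))
    (hl2 : l2 = ((s * r - 2 * t) - α * β) / ((s * r - 2 * t) + α * β))
    (hl3 : l3 = ((t * s - 2 * r) - β * γ) / ((t * s - 2 * r) + β * γ)) :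
    l1 / (1 + l1) ^ 2 =
        (r ^ 2 + s ^ 2 + t ^ 2 - r * s * t - 4) / (r * t - 2 * s) ^ 2 ∧
      l2 / (1 + l2) ^ 2 =
        (r ^ 2 + s ^ 2 + t ^ 2 - r * s * t - 4) / (s * r - 2 * t) ^ 2 ∧
      l3 / (1 + l3) ^ 2 =
        (r ^ 2 + s ^ 2 + t ^ 2 - r * s * t - 4) / (t * s - 2 * r) ^ 2 := by
  have two : (2 : K) ≠ 0 := by
    intro h
    have h' : ((2 : ℕ) : K) = 0 := by exact_mod_cast h
    have := Nat.le_of_dvd (by norm_num) ((CharP.cast_eq_zero_iff K p 2).1 h')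
    omega
  subst hl1 hl2 hl3
  refine ⟨ciani_aux two _ _ _ h1 hd1 ?_, ciani_aux two _ _ _ h2 hd2 ?_,
    ciani_aux two _ _ _ h3 hd3 ?_⟩
  · rw [mul_pow, hγ, hα]
    ring
  · rw [mul_pow, hα, hβ]
    ring
  · rw [mul_pow, hβ, hγ]
    ring
end

section
/- Let K be a field of characteristic p ≥ 3 and r, s, t ∈ K with r² ≠ 4, s² ≠ 4, t² ≠ 4, r² + s² + t² − rst − 4 ≠ 0, rt − 2s ≠ 0, sr − 2t ≠ 0 and ts − 2r ≠ 0. Fix α, β, γ ∈ K with α² = r² − 4, β² = s² − 4, γ² = t² − 4, assume (rt − 2s) + γα ≠ 0, (sr − 2t) + αβ ≠ 0, (ts − 2r) + βγ ≠ 0, and define λ₁ = ((rt−2s) − γα)/((rt−2s) + γα), λ₂ = ((sr−2t) − αβ)/((sr−2t) + αβ), λ₃ = ((ts−2r) − βγ)/((ts−2r) + βγ). Then there exist m, n, k ∈ K with m² = λ₁λ₂, n² = λ₂λ₃, k² = λ₃λ₁ such that r = (λ₁λ₂ − λ₂λ₃ − λ₃λ₁ + 1)/(m·(1 − λ₃)),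 s = (λ₂λ₃ − λ₃λ₁ − λ₁λ₂ + 1)/(n·(1 − λ₁)), and t = (λ₃λ₁ − λ₁λ₂ − λ₂λ₃ + 1)/(k·(1 − λ₂)). -/
/-- The key identity for one coordinate. -/
theorem ciani_key {K : Type*} [Field K] (h20 : (2 : K) ≠ 0)
    (r s t α β γ l1 l2 l3 : K)
    (hs : s ^ 2 ≠ 4) (ht : t ^ 2 ≠ 4)
    (hΔ : r ^ 2 + s ^ 2 + t ^ 2 - r * s * t - 4 ≠ 0)
    (hα : α ^ 2 = r ^ 2 - 4) (hβ : β ^ 2 = s ^ 2 - 4) (hγ : γ ^ 2 = t ^ 2 - 4)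
    (hd1 : (r * t - 2 * s) + γ * α ≠ 0)
    (hd2 : (s * r - 2 * t) + α * β ≠ 0)
    (hd3 : (t * s - 2 * r) + β * γ ≠ 0)
    (hl1 : l1 = ((r * t - 2 * s) - γ * α) / ((r * t - 2 * s) + γ * α))
    (hl2 : l2 = ((s * r - 2 * t) - α * β) / ((s * r - 2 * t) + α * β))
    (hl3 : l3 = ((t * s - 2 * r) - β * γ) / ((t * s - 2 * r) + β * γ)) :
    ∃ m : K, m ^ 2 = l1 * l2 ∧
      r = (l1 * l2 - l2 * l3 - l3 * l1 + 1) / (m * (1 - l3)) := by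
  have h4 : (4 : K) ≠ 0 := by
    have : (4 : K) = 2 * 2 := by norm_num
    rw [this]; exact mul_ne_zero h20 h20
  have hβ0 : β ≠ 0 := by
    rintro rfl; apply hs; linear_combination -hβ
  have hγ0 : γ ≠ 0 := by
    rintro rfl; apply ht; linear_combination -hγ
  have h3 : 1 - l3 = 2 * β * γ / ((t * s - 2 * r) + β * γ) := by
    rw [hl3]; field_simp; ring
  have h30 : 1 - l3 ≠ 0 := by
    rw [h3]; exact div_ne_zero (mul_ne_zero (mul_ne_zero h20 hβ0) hγ0) hd3
  set m := -(4 * (r ^ 2 + s ^ 2 + t ^ 2 - r * s * t - 4)) /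
    (((r * t - 2 * s) + γ * α) * ((s * r - 2 * t) + α * β)) with hm
  have hm0 : m ≠ 0 := by
    rw [hm]
    refine div_ne_zero ?_ (mul_ne_zero hd1 hd2)
    exact neg_ne_zero.2 (mul_ne_zero h4 hΔ)
  refine ⟨m, ?_, ?_⟩
  · rw [hm, hl1, hl2, div_pow, div_mul_div_comm, div_eq_div_iff (pow_ne_zero 2 (mul_ne_zero hd1 hd2)) (mul_ne_zero hd1 hd2)]
    have e1 : ((r * t - 2 * s) - γ * α) * ((r * t - 2 * s) + γ * α) = 4 * (r ^ 2 + s ^ 2 + t ^ 2 - r * s * t - 4) := by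
      linear_combination (-γ^2) * hα - (r^2-4) * hγ
    have e2 : ((s * r - 2 * t) - α * β) * ((s * r - 2 * t) + α * β) = 4 * (r ^ 2 + s ^ 2 + t ^ 2 - r * s * t - 4) := by
      linear_combination (-β^2) * hα - (r^2-4) * hβ
    generalize (r * t - 2 * s) + γ * α = D1 at *
    generalize (s * r - 2 * t) + α * β = D2 at *
    generalize 4 * (r ^ 2 + s ^ 2 + t ^ 2 - r * s * t - 4) = d at *
    generalize (r * t - 2 * s) - γ * α = N1 at *
    generalize (s * r - 2 * t) - α * β = N2 at *
    linear_combination (-D1 * D2 * d) * e1 - (D1 * D2 * N1 * D1) * e2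
  · rw [eq_div_iff (mul_ne_zero hm0 h30), h3, hm, hl1, hl2, hl3]
    clear hm0 h30 h3 hm m hl1 hl2 hl3 l1 l2 l3
    obtain ⟨u, hu⟩ : ∃ u, u = (r + α) / 2 := ⟨_, rfl⟩
    obtain ⟨v, hv⟩ : ∃ v, v = (s + β) / 2 := ⟨_, rfl⟩
    obtain ⟨w, hw⟩ : ∃ w, w = (t + γ) / 2 := ⟨_, rfl⟩
    have key : ∀ r α u : K, α ^ 2 = r ^ 2 - 4 → u = (r + α) / 2 →
        u ≠ 0 ∧ r = u + 1 / u ∧ α = u - 1 / u := by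
      intro r α u h hu
      have e : u * ((r - α) / 2) = 1 := by
        rw [hu]; field_simp; linear_combination -h
      have hu0 : u ≠ 0 := left_ne_zero_of_mul_eq_one e
      have e' : 1 / u = (r - α) / 2 := by
        rw [div_eq_iff hu0]; linear_combination -e
      refine ⟨hu0, ?_, ?_⟩
      · rw [e', hu]; field_simp; ring
      · rw [e', hu]; field_simp; ring
    obtain ⟨u0, rfl, rfl⟩ := key r α u hα hu
    obtain ⟨v0, rfl, rfl⟩ := key s β v hβ hv
    obtain ⟨w0, rfl, rfl⟩ := key t γ w hγ hw
    rw [← sub_eq_zero]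
    have f1 : ((u + 1/u) * (w + 1/w) - 2 * (v + 1/v)) + (w - 1/w) * (u - 1/u) = 2 * (u*w - v) * (u*v*w-1) / (u*v*w) := by
      field_simp; ring
    have f2 : ((v + 1/v) * (u + 1/u) - 2 * (w + 1/w)) + (u - 1/u) * (v - 1/v) = 2 * (u*v - w) * (u*v*w-1) / (u*v*w) := by
      field_simp; ring
    have f3 : ((w + 1/w) * (v + 1/v) - 2 * (u + 1/u)) + (v - 1/v) * (w - 1/w) = 2 * (v*w - u) * (u*v*w-1) / (u*v*w) := by
      field_simp; ring
    rw [f1] at hd1 ⊢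
    rw [f2] at hd2 ⊢
    rw [f3] at hd3 ⊢
    have g : u*v*w-1 ≠ 0 := by intro h; simp [h] at hd1
    have g1 : u*w-v ≠ 0 := by intro h; simp [h] at hd1
    have g2 : u*v-w ≠ 0 := by intro h; simp [h] at hd2
    have g3 : v*w-u ≠ 0 := by intro h; simp [h] at hd3
    clear hd1 hd2 hd3 f1 f2 f3 hΔ hs ht hα hβ hγ hu hv hw key
    field_simp
    ring


/-- Proposition 3.2 of the paper: the reverse transformation recovering
`r`, `s`, `t` from the Legendre parameters `λ₁`, `λ₂`, `λ₃` of the three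
quotient elliptic curves of a Ciani curve. -/
theorem ciani_reverse_transformation (K : Type*) [Field K]
    (p : ℕ) [Fact p.Prime] [CharP K p] (hp : 3 ≤ p)
    (r s t α β γ l1 l2 l3 : K)
    (hr : r ^ 2 ≠ 4) (hs : s ^ 2 ≠ 4) (ht : t ^ 2 ≠ 4)
    (hΔ : r ^ 2 + s ^ 2 + t ^ 2 - r * s * t - 4 ≠ 0)
    (h1 : r * t - 2 * s ≠ 0) (h2 : s * r - 2 * t ≠ 0) (h3 : t * s - 2 * r ≠ 0)
    (hα : α ^ 2 = r ^ 2 - 4) (hβ : β ^ 2 = s ^ 2 - 4) (hγ : γ ^ 2 = t ^ 2 - 4)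
    (hd1 : (r * t - 2 * s) + γ * α ≠ 0)
    (hd2 : (s * r - 2 * t) + α * β ≠ 0)
    (hd3 : (t * s - 2 * r) + β * γ ≠ 0)
    (hl1 : l1 = ((r * t - 2 * s) - γ * α) / ((r * t - 2 * s) + γ * α))
    (hl2 : l2 = ((s * r - 2 * t) - α * β) / ((s * r - 2 * t) + α * β))
    (hl3 : l3 = ((t * s - 2 * r) - β * γ) / ((t * s - 2 * r) + β * γ)) :
    ∃ m n k : K, m ^ 2 = l1 * l2 ∧ n ^ 2 = l2 * l3 ∧ k ^ 2 = l3 * l1 ∧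
      r = (l1 * l2 - l2 * l3 - l3 * l1 + 1) / (m * (1 - l3)) ∧
      s = (l2 * l3 - l3 * l1 - l1 * l2 + 1) / (n * (1 - l1)) ∧
      t = (l3 * l1 - l1 * l2 - l2 * l3 + 1) / (k * (1 - l2)) := by

  have h20 : (2 : K) ≠ 0 := by
    have : NeZero (2 : K) := by
      refine ⟨fun h => ?_⟩
      have h' : ((2 : ℕ) : K) = 0 := by exact_mod_cast h
      have := (CharP.cast_eq_zero_iff K p 2).1 h'
      have := Nat.le_of_dvd (by norm_num) this
      omega
    exact two_ne_zero
  obtain ⟨m, hm, hm'⟩ := ciani_key h20 r s t α β γ l1 l2 l3 hs ht hΔ hα hβ hγ hd1 hd2 hd3 hl1 hl2 hl3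
  obtain ⟨n, hn, hn'⟩ := ciani_key h20 s t r β γ α l2 l3 l1 ht hr
    (by intro h; apply hΔ; linear_combination h) hβ hγ hα hd2 hd3 hd1 hl2 hl3 hl1
  obtain ⟨k, hk, hk'⟩ := ciani_key h20 t r s γ α β l3 l1 l2 hr hs
    (by intro h; apply hΔ; linear_combination h) hγ hα hβ hd3 hd1 hd2 hl3 hl1 hl2
  exact ⟨m, n, k, hm, hn, hk, hm', hn', hk'⟩
end

section
/- Let K be a field of characteristic p ≥ 3 and r, s, t ∈ K with r² ≠ 4, s² ≠ 4, t² ≠ 4 and r² + s² + t² − rst − 4 ≠ 0. Fix α, β, γ ∈ K with α² = r² − 4, β² = s² − 4, γ² = t² − 4, assume (rt − 2s) + γα ≠ 0, (sr − 2t) + αβ ≠ 0, (ts − 2r) + βγ ≠ 0, define λ₁ = ((rt−2s) − γα)/((rt−2s) + γα), λ₂ = ((sr−2t) − αβ)/((sr−2t) + αβ), λ₃ = ((ts−2r) − βγ)/((ts−2r) + βγ), and set D = (λ₁λ₂ + λ₂λ₃ + λ₃λ₁ − 1)² − 4·λ₁λ₂λ₃·(λ₁ + λ₂ + λ₃ −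 2). Then λ₁, λ₂, λ₃ and 1 − λ₁, 1 − λ₂, 1 − λ₃ are all nonzero and r² − 4 = D/(λ₁λ₂·(1−λ₃)²), s² − 4 = D/(λ₂λ₃·(1−λ₁)²), t² − 4 = D/(λ₃λ₁·(1−λ₂)²). -/
lemma ciani_param {K : Type*} [Field K] (h2 : (2 : K) ≠ 0) (r α : K) (h : α ^ 2 = r ^ 2 - 4) :
    ∃ u : K, u ≠ 0 ∧ r = u + u⁻¹ ∧ α = u - u⁻¹ := by
  have hm : ((r + α) / 2) * ((r - α) / 2) = 1 := by
    field_simp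
    linear_combination -h
  have hu : (r + α) / 2 ≠ 0 := left_ne_zero_of_mul_eq_one hm
  have hi : ((r + α) / 2)⁻¹ = (r - α) / 2 := inv_eq_of_mul_eq_one_right hm
  refine ⟨(r + α) / 2, hu, ?_, ?_⟩
  · rw [hi]; field_simp; ring
  · rw [hi]; field_simp; ring

/-- The formulas expressing `r² − 4`, `s² − 4`, `t² − 4` in terms of the
Legendre parameters of the three quotient elliptic curves of a Ciani curve. -/
theorem ciani_r_sq_sub_four_formula (K : Type*) [Field K]
    (p : ℕ) [Fact p.Prime] [CharP K p] (hp : 3 ≤ p)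
    (r s t α β γ l1 l2 l3 D : K)
    (hr : r ^ 2 ≠ 4) (hs : s ^ 2 ≠ 4) (ht : t ^ 2 ≠ 4)
    (hΔ : r ^ 2 + s ^ 2 + t ^ 2 - r * s * t - 4 ≠ 0)
    (hα : α ^ 2 = r ^ 2 - 4) (hβ : β ^ 2 = s ^ 2 - 4) (hγ : γ ^ 2 = t ^ 2 - 4)
    (hd1 : (r * t - 2 * s) + γ * α ≠ 0)
    (hd2 : (s * r - 2 * t) + α * β ≠ 0)
    (hd3 : (t * s - 2 * r) + β * γ ≠ 0)
    (hl1 : l1 = ((r * t - 2 * s) - γ * α) / ((r * t - 2 * s) + γ * α))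
    (hl2 : l2 = ((s * r - 2 * t) - α * β) / ((s * r - 2 * t) + α * β))
    (hl3 : l3 = ((t * s - 2 * r) - β * γ) / ((t * s - 2 * r) + β * γ))
    (hD : D = (l1 * l2 + l2 * l3 + l3 * l1 - 1) ^ 2
        - 4 * (l1 * l2 * l3) * (l1 + l2 + l3 - 2)) :
    l1 ≠ 0 ∧ l2 ≠ 0 ∧ l3 ≠ 0 ∧ 1 - l1 ≠ 0 ∧ 1 - l2 ≠ 0 ∧ 1 - l3 ≠ 0 ∧
      r ^ 2 - 4 = D / (l1 * l2 * (1 - l3) ^ 2) ∧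
      s ^ 2 - 4 = D / (l2 * l3 * (1 - l1) ^ 2) ∧
      t ^ 2 - 4 = D / (l3 * l1 * (1 - l2) ^ 2) := by
  have h2 : (2 : K) ≠ 0 := by
    intro h
    have h' : ((2 : ℕ) : K) = 0 := by exact_mod_cast h
    have := Nat.le_of_dvd (by norm_num) ((CharP.cast_eq_zero_iff K p 2).1 h')
    omega
  have hα0 : α ≠ 0 := by
    rintro rfl
    exact hr (by linear_combination -hα)
  have hβ0 : β ≠ 0 := by
    rintro rfl
    exact hs (by linear_combination -hβ)
  have hγ0 : γ ≠ 0 := by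
    rintro rfl
    exact ht (by linear_combination -hγ)
  have e1 : 1 - l1 = 2 * (γ * α) / ((r * t - 2 * s) + γ * α) := by
    rw [hl1]; field_simp; ring
  have e2 : 1 - l2 = 2 * (α * β) / ((s * r - 2 * t) + α * β) := by
    rw [hl2]; field_simp; ring
  have e3 : 1 - l3 = 2 * (β * γ) / ((t * s - 2 * r) + β * γ) := by
    rw [hl3]; field_simp; ring
  have m1 : 1 - l1 ≠ 0 := by
    rw [e1]; exact div_ne_zero (mul_ne_zero h2 (mul_ne_zero hγ0 hα0)) hd1
  have m2 : 1 - l2 ≠ 0 := by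
    rw [e2]; exact div_ne_zero (mul_ne_zero h2 (mul_ne_zero hα0 hβ0)) hd2
  have m3 : 1 - l3 ≠ 0 := by
    rw [e3]; exact div_ne_zero (mul_ne_zero h2 (mul_ne_zero hβ0 hγ0)) hd3
  obtain ⟨u, hu, ru, au⟩ := ciani_param h2 r α hα
  obtain ⟨v, hv, rv, av⟩ := ciani_param h2 s β hβ
  obtain ⟨w, hw, rw', aw⟩ := ciani_param h2 t γ hγ
  obtain ⟨A, hA⟩ : ∃ A, A = v * w - u := ⟨_, rfl⟩
  obtain ⟨B, hB⟩ : ∃ B, B = u * w - v := ⟨_, rfl⟩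
  obtain ⟨C, hC⟩ : ∃ C, C = u * v - w := ⟨_, rfl⟩
  obtain ⟨F, hF⟩ : ∃ F, F = u * v * w - 1 := ⟨_, rfl⟩
  have d1 : (r * t - 2 * s) + γ * α = 2 * (B * F) / (u * v * w) := by
    rw [ru, rv, rw', au, aw, hB, hF]; field_simp; ring
  have d2 : (s * r - 2 * t) + α * β = 2 * (C * F) / (u * v * w) := by
    rw [ru, rv, rw', au, av, hC, hF]; field_simp; ring
  have d3 : (t * s - 2 * r) + β * γ = 2 * (A * F) / (u * v * w) := by
    rw [ru, rv, rw', av, aw, hA, hF]; field_simp; ring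
  have n1 : (r * t - 2 * s) - γ * α = -2 * (A * C) / (u * v * w) := by
    rw [ru, rv, rw', au, aw, hA, hC]; field_simp; ring
  have n2 : (s * r - 2 * t) - α * β = -2 * (A * B) / (u * v * w) := by
    rw [ru, rv, rw', au, av, hA, hB]; field_simp; ring
  have n3 : (t * s - 2 * r) - β * γ = -2 * (B * C) / (u * v * w) := by
    rw [ru, rv, rw', av, aw, hB, hC]; field_simp; ring
  have hA0 : A ≠ 0 := by
    rintro rfl
    exact hd3 (by rw [d3]; simp)
  have hB0 : B ≠ 0 := by
    rintro rfl
    exact hd1 (by rw [d1]; simp)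
  have hC0 : C ≠ 0 := by
    rintro rfl
    exact hd2 (by rw [d2]; simp)
  have hF0 : F ≠ 0 := by
    rintro rfl
    exact hd2 (by rw [d2]; simp)
  have k1 : l1 = -(A * C) / (B * F) := by
    rw [hl1, n1, d1]; field_simp
  have k2 : l2 = -(A * B) / (C * F) := by
    rw [hl2, n2, d2]; field_simp
  have k3 : l3 = -(B * C) / (A * F) := by
    rw [hl3, n3, d3]; field_simp
  have z1 : l1 ≠ 0 := by
    rw [k1]; exact div_ne_zero (neg_ne_zero.2 (mul_ne_zero hA0 hC0)) (mul_ne_zero hB0 hF0)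
  have z2 : l2 ≠ 0 := by
    rw [k2]; exact div_ne_zero (neg_ne_zero.2 (mul_ne_zero hA0 hB0)) (mul_ne_zero hC0 hF0)
  have z3 : l3 ≠ 0 := by
    rw [k3]; exact div_ne_zero (neg_ne_zero.2 (mul_ne_zero hB0 hC0)) (mul_ne_zero hA0 hF0)
  have kD : D = ((A ^ 2 + B ^ 2 + C ^ 2 - F ^ 2) ^ 2
      - 4 * (A ^ 2 * B ^ 2 + B ^ 2 * C ^ 2 + C ^ 2 * A ^ 2) - 8 * (A * B * C * F)) / F ^ 4 := by
    rw [hD, k1, k2, k3]; field_simp; ring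
  refine ⟨z1, z2, z3, m1, m2, m3, ?_, ?_, ?_⟩
  · rw [eq_div_iff (mul_ne_zero (mul_ne_zero z1 z2) (pow_ne_zero 2 m3))]
    have : l1 * l2 * (1 - l3) ^ 2 = (A * F + B * C) ^ 2 / F ^ 4 := by
      rw [k1, k2, k3]; field_simp; ring
    rw [this, kD, ru, hA, hB, hC, mul_div_assoc']
    congr 1
    rw [hF]; field_simp; ring
  · rw [eq_div_iff (mul_ne_zero (mul_ne_zero z2 z3) (pow_ne_zero 2 m1))]
    have : l2 * l3 * (1 - l1) ^ 2 = (B * F + A * C) ^ 2 / F ^ 4 := by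
      rw [k1, k2, k3]; field_simp; ring
    rw [this, kD, rv, hA, hB, hC, mul_div_assoc']
    congr 1
    rw [hF]; field_simp; ring
  · rw [eq_div_iff (mul_ne_zero (mul_ne_zero z3 z1) (pow_ne_zero 2 m2))]
    have : l3 * l1 * (1 - l2) ^ 2 = (C * F + A * B) ^ 2 / F ^ 4 := by
      rw [k1, k2, k3]; field_simp; ring
    rw [this, kD, rw', hA, hB, hC, mul_div_assoc']
    congr 1
    rw [hF]; field_simp; ring
end

section
/- Let K be a field of characteristic p ≥ 3 and r, s, t ∈ K with r² ≠ 4, s² ≠ 4, t² ≠ 4 and r² + s² + t² − rst − 4 ≠ 0. Fix α, β, γ ∈ K with α² = r² − 4, β² = s² − 4, γ² = t² − 4, assume (rt − 2s) + γα ≠ 0, (sr − 2t) + αβ ≠ 0, (ts − 2r) + βγ ≠ 0, and define λ₁ = ((rt−2s) − γα)/((rt−2s) + γα), λ₂ = ((sr−2t) − αβ)/((sr−2t) + αβ), λ₃ = ((ts−2r) − βγ)/((ts−2r) + βγ). Then (r² − 4)/(t² − 4) = λ₃·(1 − λ₂)²/(λ₂·(1 − λ₃)²), (s² − 4)/(r²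 − 4) = λ₁·(1 − λ₃)²/(λ₃·(1 − λ₁)²), and (t² − 4)/(s² − 4) = λ₂·(1 − λ₁)²/(λ₁·(1 − λ₂)²). -/
/-- For `l = (A - b) / (A + b)` with `A² - b² = 4Δ`: nonvanishing and `(1 - l)² Δ = l b²`. -/
lemma ciani_aux_s9 {K : Type*} [Field K] (h2 : (2 : K) ≠ 0) (A b D l : K) (hD : D ≠ 0)
    (hb : b ≠ 0) (hd : A + b ≠ 0) (hl : l = (A - b) / (A + b))
    (h : A ^ 2 - b ^ 2 = 4 * D) :
    l ≠ 0 ∧ 1 - l ≠ 0 ∧ (1 - l) ^ 2 * D = l * b ^ 2 := by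
  have h4 : (4 : K) ≠ 0 := by
    have : (4 : K) = 2 * 2 := by norm_num
    rw [this]; exact mul_ne_zero h2 h2
  have hn : A - b ≠ 0 := by
    intro h0
    apply mul_ne_zero h4 hD
    linear_combination (A + b) * h0 - h
  have h1 : 1 - l = 2 * b / (A + b) := by
    rw [hl]; field_simp; ring
  refine ⟨?_, ?_, ?_⟩
  · rw [hl]; exact div_ne_zero hn hd
  · rw [h1]; exact div_ne_zero (mul_ne_zero h2 hb) hd
  · rw [h1, hl]; field_simp; linear_combination -h

/-- Combine two of the relations. -/
lemma ciani_ratio_aux {K : Type*} [Field K] (a b c D l m : K) (hD : D ≠ 0)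
    (hb : b ≠ 0) (hc : c ≠ 0) (hl : l ≠ 0) (hm : 1 - m ≠ 0)
    (h1 : (1 - l) ^ 2 * D = l * (a * b) ^ 2) (h2 : (1 - m) ^ 2 * D = m * (b * c) ^ 2) :
    a ^ 2 / c ^ 2 = m * (1 - l) ^ 2 / (l * (1 - m) ^ 2) := by
  rw [div_eq_div_iff (pow_ne_zero 2 hc) (mul_ne_zero hl (pow_ne_zero 2 hm))]
  apply mul_right_cancel₀ hD
  linear_combination a ^ 2 * l * h2 - m * c ^ 2 * h1

/-- The ratios `(r²−4)/(t²−4)` etc. in terms of the Legendre parameters of the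
three quotient elliptic curves of a Ciani curve. -/
theorem ciani_ratio_formulas (K : Type*) [Field K]
    (p : ℕ) [Fact p.Prime] [CharP K p] (hp : 3 ≤ p)
    (r s t α β γ l1 l2 l3 : K)
    (hr : r ^ 2 ≠ 4) (hs : s ^ 2 ≠ 4) (ht : t ^ 2 ≠ 4)
    (hΔ : r ^ 2 + s ^ 2 + t ^ 2 - r * s * t - 4 ≠ 0)
    (hα : α ^ 2 = r ^ 2 - 4) (hβ : β ^ 2 = s ^ 2 - 4) (hγ : γ ^ 2 = t ^ 2 - 4)
    (hd1 : (r * t - 2 * s) + γ * α ≠ 0)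
    (hd2 : (s * r - 2 * t) + α * β ≠ 0)
    (hd3 : (t * s - 2 * r) + β * γ ≠ 0)
    (hl1 : l1 = ((r * t - 2 * s) - γ * α) / ((r * t - 2 * s) + γ * α))
    (hl2 : l2 = ((s * r - 2 * t) - α * β) / ((s * r - 2 * t) + α * β))
    (hl3 : l3 = ((t * s - 2 * r) - β * γ) / ((t * s - 2 * r) + β * γ)) :
    (r ^ 2 - 4) / (t ^ 2 - 4) = l3 * (1 - l2) ^ 2 / (l2 * (1 - l3) ^ 2) ∧
      (s ^ 2 - 4) / (r ^ 2 - 4) = l1 * (1 - l3) ^ 2 / (l3 * (1 - l1) ^ 2) ∧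
      (t ^ 2 - 4) / (s ^ 2 - 4) = l2 * (1 - l1) ^ 2 / (l1 * (1 - l2) ^ 2) := by
  have h2 : (2 : K) ≠ 0 := by
    apply Ring.two_ne_zero
    rw [ringChar.eq K p]
    omega
  have ha : α ≠ 0 := by
    rintro rfl; exact hr (by linear_combination -hα)
  have hb : β ≠ 0 := by
    rintro rfl; exact hs (by linear_combination -hβ)
  have hc : γ ≠ 0 := by
    rintro rfl; exact ht (by linear_combination -hγ)
  obtain ⟨n1, m1, e1⟩ := ciani_aux_s9 h2 _ _ _ l1 hΔ (mul_ne_zero hc ha) hd1 hl1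
    (by rw [mul_pow, hα, hγ]; ring)
  obtain ⟨n2, m2, e2⟩ := ciani_aux_s9 h2 _ _ _ l2 hΔ (mul_ne_zero ha hb) hd2 hl2
    (by rw [mul_pow, hα, hβ]; ring)
  obtain ⟨n3, m3, e3⟩ := ciani_aux_s9 h2 _ _ _ l3 hΔ (mul_ne_zero hb hc) hd3 hl3
    (by rw [mul_pow, hβ, hγ]; ring)
  rw [← hα, ← hβ, ← hγ]
  exact ⟨ciani_ratio_aux α β γ _ l2 l3 hΔ hb hc n2 m3 e2 e3,
    ciani_ratio_aux β γ α _ l3 l1 hΔ hc ha n3 m1 e3 e1,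
    ciani_ratio_aux γ α β _ l1 l2 hΔ ha hb n1 m2 e1 e2⟩
end

section
/- Let p ≥ 3 be a prime, F the finite field with p² elements, and r, s, t ∈ F with r² ≠ 4, s² ≠ 4, t² ≠ 4 and r² + s² + t² − rst − 4 ≠ 0. Fix α, β, γ ∈ F with α² = r² − 4, β² = s² − 4, γ² = t² − 4, assume (rt − 2s) + γα ≠ 0, (sr − 2t) + αβ ≠ 0, (ts − 2r) + βγ ≠ 0, and define λ₁ = ((rt−2s) − γα)/((rt−2s) + γα), λ₂ = ((sr−2t) − αβ)/((sr−2t) + αβ), λ₃ = ((ts−2r) − βγ)/((ts−2r) + βγ). If each λᵢ and each 1 − λᵢ (i = 1, 2, 3) is a fourth power in F, then (r² − 4)/(t² − 4), (s² − 4)/(r² − 4) and (t² − 4)/(s² − 4) are fourth powers in F. -/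
/-- Key identity: the ratio of squares is `(λ₂/λ₁)·((1-λ₁)/(1-λ₂))²`. -/
lemma ciani_key_s10 {F : Type*} [Field F] (h2 : (2 : F) ≠ 0) (A B x y z l m D : F)
    (hx : x ≠ 0) (hy : y ≠ 0) (hz : z ≠ 0) (hD : D ≠ 0)
    (hA : A ^ 2 - (x * y) ^ 2 = 4 * D) (hB : B ^ 2 - (x * z) ^ 2 = 4 * D)
    (hdA : A + x * y ≠ 0) (hdB : B + x * z ≠ 0)
    (hl : l = (A - x * y) / (A + x * y)) (hm : m = (B - x * z) / (B + x * z))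
    (hp1 : ∃ b : F, l = b ^ 4) (hp2 : ∃ b : F, m = b ^ 4)
    (hq1 : ∃ b : F, 1 - l = b ^ 4) (hq2 : ∃ b : F, 1 - m = b ^ 4) :
    ∃ b : F, y ^ 2 / z ^ 2 = b ^ 4 := by
  obtain ⟨a, ha⟩ := hp1
  obtain ⟨b, hb⟩ := hp2
  obtain ⟨c, hc⟩ := hq1
  obtain ⟨d, hd⟩ := hq2
  have h4 : (4 : F) ≠ 0 := by
    have : (4 : F) = 2 * 2 := by norm_num
    rw [this]; exact mul_ne_zero h2 h2
  have e1 : l = 4 * D / (A + x * y) ^ 2 := by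
    rw [hl, ← hA]; field_simp; ring
  have e2 : m = 4 * D / (B + x * z) ^ 2 := by
    rw [hm, ← hB]; field_simp; ring
  have e3 : 1 - l = 2 * x * y / (A + x * y) := by
    rw [hl]; field_simp; ring
  have e4 : 1 - m = 2 * x * z / (B + x * z) := by
    rw [hm]; field_simp; ring
  refine ⟨b * c ^ 2 / (a * d ^ 2), ?_⟩
  have : (b * c ^ 2 / (a * d ^ 2)) ^ 4 = (b ^ 4) * (c ^ 4) ^ 2 / ((a ^ 4) * (d ^ 4) ^ 2) := by
    rw [div_pow]; congr 1 <;> ring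
  rw [this, ← ha, ← hb, ← hc, ← hd, e3, e4, e1, e2]
  clear e1 e2 e3 e4 hl hm
  generalize A + x * y = P at *
  generalize B + x * z = Q at *
  field_simp

/-- Lemma 4.3 of the paper: if the Legendre parameters `λᵢ` and `1 − λᵢ` of the
three quotient elliptic curves of a Ciani curve over `𝔽_{p²}` are fourth powers,
then `(r²−4)/(t²−4)`, `(s²−4)/(r²−4)` and `(t²−4)/(s²−4)` are fourth powers. -/
theorem ciani_ratios_fourth_powers (p : ℕ) [Fact p.Prime] (hp : 3 ≤ p)
    (F : Type*) [Field F] [Fintype F] (hF : Fintype.card F = p ^ 2)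
    (r s t α β γ l1 l2 l3 : F)
    (hr : r ^ 2 ≠ 4) (hs : s ^ 2 ≠ 4) (ht : t ^ 2 ≠ 4)
    (hΔ : r ^ 2 + s ^ 2 + t ^ 2 - r * s * t - 4 ≠ 0)
    (hα : α ^ 2 = r ^ 2 - 4) (hβ : β ^ 2 = s ^ 2 - 4) (hγ : γ ^ 2 = t ^ 2 - 4)
    (hd1 : (r * t - 2 * s) + γ * α ≠ 0)
    (hd2 : (s * r - 2 * t) + α * β ≠ 0)
    (hd3 : (t * s - 2 * r) + β * γ ≠ 0)
    (hl1 : l1 = ((r * t - 2 * s) - γ * α) / ((r * t - 2 * s) + γ * α))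
    (hl2 : l2 = ((s * r - 2 * t) - α * β) / ((s * r - 2 * t) + α * β))
    (hl3 : l3 = ((t * s - 2 * r) - β * γ) / ((t * s - 2 * r) + β * γ))
    (hp1 : ∃ b : F, l1 = b ^ 4) (hp2 : ∃ b : F, l2 = b ^ 4)
    (hp3 : ∃ b : F, l3 = b ^ 4)
    (hq1 : ∃ b : F, 1 - l1 = b ^ 4) (hq2 : ∃ b : F, 1 - l2 = b ^ 4)
    (hq3 : ∃ b : F, 1 - l3 = b ^ 4) :
    (∃ b : F, (r ^ 2 - 4) / (t ^ 2 - 4) = b ^ 4) ∧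
      (∃ b : F, (s ^ 2 - 4) / (r ^ 2 - 4) = b ^ 4) ∧
      (∃ b : F, (t ^ 2 - 4) / (s ^ 2 - 4) = b ^ 4) := by
  have h2 : (2 : F) ≠ 0 := by
    intro h
    have hodd : Odd (p ^ 2) :=
      ((Fact.out : p.Prime).odd_of_ne_two (by omega)).pow
    obtain ⟨k, hk⟩ := hodd
    have hc : ((Fintype.card F : ℕ) : F) = 0 := by
      rw [← Nat.card_eq_fintype_card]; simp
    rw [hF, hk] at hc
    push_cast at hc
    rw [h] at hc
    simp at hc
  have nα : α ≠ 0 := by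
    rintro rfl; apply hr; linear_combination -hα
  have nβ : β ≠ 0 := by
    rintro rfl; apply hs; linear_combination -hβ
  have nγ : γ ≠ 0 := by
    rintro rfl; apply ht; linear_combination -hγ
  have i1 : (r * t - 2 * s) ^ 2 - (γ * α) ^ 2
      = 4 * (r ^ 2 + s ^ 2 + t ^ 2 - r * s * t - 4) := by
    rw [mul_pow, hα, hγ]; ring
  have i2 : (s * r - 2 * t) ^ 2 - (α * β) ^ 2
      = 4 * (r ^ 2 + s ^ 2 + t ^ 2 - r * s * t - 4) := by
    rw [mul_pow, hα, hβ]; ring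
  have i3 : (t * s - 2 * r) ^ 2 - (β * γ) ^ 2
      = 4 * (r ^ 2 + s ^ 2 + t ^ 2 - r * s * t - 4) := by
    rw [mul_pow, hβ, hγ]; ring
  rw [← hα, ← hβ, ← hγ]
  refine ⟨?_, ?_, ?_⟩
  · rw [mul_comm α β] at i2 hd2 hl2
    exact ciani_key_s10 h2 _ _ β α γ l2 l3 _ nβ nα nγ hΔ i2 i3 hd2 hd3 hl2 hl3 hp2 hp3 hq2 hq3
  · rw [mul_comm β γ] at i3 hd3 hl3
    exact ciani_key_s10 h2 _ _ γ β α l3 l1 _ nγ nβ nα hΔ i3 i1 hd3 hd1 hl3 hl1 hp3 hp1 hq3 hq1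
  · rw [mul_comm γ α] at i1 hd1 hl1
    exact ciani_key_s10 h2 _ _ α γ β l1 l2 _ nα nγ nβ hΔ i1 i2 hd1 hd2 hl1 hl2 hp1 hp2 hq1 hq2
end

section
/- Let p ≥ 3 be a prime and F the finite field with p² elements. Let r, s, t ∈ F and e ∈ F with e² = (r² − 4)·(t² − 4) and (rt − 2s) + e ≠ 0. If ((rt − 2s) − e)/((rt − 2s) + e) is a square in F, then r² + s² + t² − rst − 4 is a square in F, i.e. there exists Δ ∈ F with Δ² = r² + s² + t² − rst − 4. -/
/-- Lemma 4.2(2) of the paper: if the Legendre parameter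
`((rt−2s) − e)/((rt−2s) + e)` (with `e² = (r²−4)(t²−4)`) is a square in
`𝔽_{p²}`, then `r² + s² + t² − rst − 4` is a square in `𝔽_{p²}`. -/
theorem ciani_delta_square (p : ℕ) [Fact p.Prime] (hp : 3 ≤ p)
    (F : Type*) [Field F] [Fintype F] (hF : Fintype.card F = p ^ 2)
    (r s t e : F) (he : e ^ 2 = (r ^ 2 - 4) * (t ^ 2 - 4))
    (hne : (r * t - 2 * s) + e ≠ 0)
    (hsq : ∃ b : F, ((r * t - 2 * s) - e) / ((r * t - 2 * s) + e) = b ^ 2) :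
    ∃ Δ : F, Δ ^ 2 = r ^ 2 + s ^ 2 + t ^ 2 - r * s * t - 4 := by
  have h2 : (2 : F) ≠ 0 := by
    intro h
    have hpp : p.Prime := Fact.out
    have hodd : Odd (p ^ 2) := (hpp.odd_of_ne_two (by omega)).pow
    obtain ⟨k, hk⟩ := hodd
    have h0 : ((Fintype.card F : ℕ) : F) = 0 := Nat.cast_card_eq_zero F
    rw [hF, hk] at h0
    push_cast at h0
    rw [h] at h0
    simp at h0
  obtain ⟨b, hb⟩ := hsq
  rw [div_eq_iff hne] at hb
  refine ⟨((r * t - 2 * s) + e) * b / 2, ?_⟩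
  rw [div_pow, div_eq_iff (pow_ne_zero 2 h2)]
  linear_combination (-((r * t - 2 * s) + e)) * hb - he
end

section
/- Let p ≥ 3 be a prime and F the finite field with p² elements. Let r, s, t, Δ ∈ F with Δ² = r² + s² + t² − rst − 4, and set μ₁ = (rt−2s) + 2Δ, ν₁ = (rt−2s) − 2Δ, μ₂ = (sr−2t) + 2Δ, ν₂ = (sr−2t) − 2Δ, μ₃ = (ts−2r) + 2Δ, ν₃ = (ts−2r) − 2Δ. Assume r² ≠ 4, s² ≠ 4, t² ≠ 4 and μ₁, μ₂, μ₃ are all nonzero; assume ν₁/μ₁, ν₂/μ₂, ν₃/μ₃ are fourth powers in F; and assume (s² − 4)/(r² − 4), (t² − 4)/(r² − 4) and (t² − 4)/(s² − 4) are fourth powers in F. Then the products μ₁μ₂, μ₂μ₃ and μ₃μ₁ are squares in F; consequently either all three of μ₁, μ₂, μ₃ are squares in F, or none of them is. -/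
lemma ciani_aux_s14 {F : Type*} [Field F] (hi : ∃ i : F, -1 = i * i) (m n A C : F)
    (hA : A ≠ 0) (hC : C ≠ 0) (hm : m ≠ 0) (hmn : m * n = A * C)
    (hq : ∃ b : F, n / m = b ^ 4) (hc : ∃ c : F, C / A = c ^ 4) :
    ∃ k : F, m = A * k ^ 2 := by
  obtain ⟨i, hi⟩ := hi
  obtain ⟨b, hb⟩ := hq
  obtain ⟨c, hc⟩ := hc
  rw [div_eq_iff hm] at hb
  rw [div_eq_iff hA] at hc
  have hb0 : b ≠ 0 := by
    rintro rfl
    apply mul_ne_zero hA hC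
    rw [← hmn, hb]; ring
  have h : (m * b ^ 2 - A * c ^ 2) * (m * b ^ 2 + A * c ^ 2) = 0 := by
    subst hb hc
    linear_combination hmn
  rcases mul_eq_zero.mp h with h | h
  · refine ⟨c / b, ?_⟩
    field_simp
    linear_combination h
  · refine ⟨i * c / b, ?_⟩
    field_simp
    linear_combination h + A * c ^ 2 * hi

/-- Lemma 4.5 of the paper: under the fourth-power hypotheses, the products
`μ₁μ₂`, `μ₂μ₃`, `μ₃μ₁` are squares in `𝔽_{p²}`; consequently either all of
`μ₁, μ₂, μ₃` are squares in `𝔽_{p²}` or none of them is. -/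
theorem ciani_mu_products_squares (p : ℕ) [Fact p.Prime] (hp : 3 ≤ p)
    (F : Type*) [Field F] [Fintype F] (hF : Fintype.card F = p ^ 2)
    (r s t Δ μ1 ν1 μ2 ν2 μ3 ν3 : F)
    (hΔ : Δ ^ 2 = r ^ 2 + s ^ 2 + t ^ 2 - r * s * t - 4)
    (hμ1 : μ1 = (r * t - 2 * s) + 2 * Δ) (hν1 : ν1 = (r * t - 2 * s) - 2 * Δ)
    (hμ2 : μ2 = (s * r - 2 * t) + 2 * Δ) (hν2 : ν2 = (s * r - 2 * t) - 2 * Δ)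
    (hμ3 : μ3 = (t * s - 2 * r) + 2 * Δ) (hν3 : ν3 = (t * s - 2 * r) - 2 * Δ)
    (hr : r ^ 2 ≠ 4) (hs : s ^ 2 ≠ 4) (ht : t ^ 2 ≠ 4)
    (h1 : μ1 ≠ 0) (h2 : μ2 ≠ 0) (h3 : μ3 ≠ 0)
    (hq1 : ∃ b : F, ν1 / μ1 = b ^ 4) (hq2 : ∃ b : F, ν2 / μ2 = b ^ 4)
    (hq3 : ∃ b : F, ν3 / μ3 = b ^ 4)
    (hr1 : ∃ b : F, (s ^ 2 - 4) / (r ^ 2 - 4) = b ^ 4)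
    (hr2 : ∃ b : F, (t ^ 2 - 4) / (r ^ 2 - 4) = b ^ 4)
    (hr3 : ∃ b : F, (t ^ 2 - 4) / (s ^ 2 - 4) = b ^ 4) :
    ((∃ b : F, μ1 * μ2 = b ^ 2) ∧ (∃ b : F, μ2 * μ3 = b ^ 2) ∧
        (∃ b : F, μ3 * μ1 = b ^ 2)) ∧
      (((∃ b : F, μ1 = b ^ 2) ∧ (∃ b : F, μ2 = b ^ 2) ∧ (∃ b : F, μ3 = b ^ 2)) ∨
        ((¬ ∃ b : F, μ1 = b ^ 2) ∧ (¬ ∃ b : F, μ2 = b ^ 2) ∧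
          (¬ ∃ b : F, μ3 = b ^ 2))) := by
  have hi : ∃ i : F, -1 = i * i := by
    have : IsSquare (-1 : F) := by
      rw [FiniteField.isSquare_neg_one_iff, hF, pow_two, Nat.mul_mod]
      have : p % 4 < 4 := Nat.mod_lt _ (by norm_num)
      interval_cases p % 4 <;> norm_num
    exact this
  have hA := sub_ne_zero.mpr hr
  have hB := sub_ne_zero.mpr hs
  have hC := sub_ne_zero.mpr ht
  obtain ⟨k1, e1⟩ := ciani_aux_s14 hi μ1 ν1 _ _ hA hC h1
    (by rw [hμ1, hν1]; linear_combination (-4) * hΔ) hq1 hr2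
  obtain ⟨k2, e2⟩ := ciani_aux_s14 hi μ2 ν2 _ _ hA hB h2
    (by rw [hμ2, hν2]; linear_combination (-4) * hΔ) hq2 hr1
  obtain ⟨k3, e3⟩ := ciani_aux_s14 hi μ3 ν3 _ _ hB hC h3
    (by rw [hμ3, hν3]; linear_combination (-4) * hΔ) hq3 hr3
  obtain ⟨c, hc⟩ := hr1
  rw [div_eq_iff hA] at hc
  rw [hc] at e3
  obtain ⟨A, hAdef⟩ : ∃ A : F, A = r ^ 2 - 4 := ⟨_, rfl⟩
  rw [← hAdef] at e1 e2 e3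
  have key : ∀ x y : F, x ≠ 0 → (∃ b, x * y = b ^ 2) → (∃ b, x = b ^ 2) → ∃ b, y = b ^ 2 := by
    rintro x y hx ⟨b, hb⟩ ⟨d, rfl⟩
    have hd : d ≠ 0 := by rintro rfl; simp at hx
    refine ⟨b / d, ?_⟩
    field_simp
    linear_combination hb
  have h12 : ∃ b : F, μ1 * μ2 = b ^ 2 := ⟨A * k1 * k2, by rw [e1, e2]; ring⟩
  have h23 : ∃ b : F, μ2 * μ3 = b ^ 2 := ⟨A * c ^ 2 * k2 * k3, by rw [e2, e3]; ring⟩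
  have h31 : ∃ b : F, μ3 * μ1 = b ^ 2 := ⟨A * c ^ 2 * k3 * k1, by rw [e3, e1]; ring⟩
  refine ⟨⟨h12, h23, h31⟩, ?_⟩
  have a := key _ _ h1 h12
  have b := key _ _ h2 h23
  have d := key _ _ h3 h31
  by_cases h : ∃ b : F, μ1 = b ^ 2
  · exact Or.inl ⟨h, a h, b (a h)⟩
  · exact Or.inr ⟨h, fun h' => h (d (b h')), fun h' => h (d h')⟩
end

section
/- Let p be a prime with p ≡ 3 (mod 4) and F the finite field with p² elements, and let c ∈ F satisfy c² = −2. Then the number of points (x : y : z) of the projective plane over F satisfying x⁴ + y⁴ + z⁴ + (3/c)·x²y² − (9/4)·y²z² + (3/c)·z²x² = 0 is exactly p² + 6p + 1. -/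
open Projectivization

namespace CianiAux

set_option linter.unusedSectionVars false

open Finset

section gen
variable {F : Type*} [Field F] [Fintype F] [DecidableEq F]

/-- The number of square roots as a sum. -/
lemma sum_sqrt (h2 : ringChar F ≠ 2) (a : F) :
    ∑ x : F, (if x ^ 2 = a then (1 : ℤ) else 0) = 1 + quadraticChar F a := by
  have h := quadraticChar_card_sqrts h2 a
  rw [Finset.sum_boole, add_comm, ← h]
  congr 2
  ext x
  simp

lemma sum_comp_sq (h2 : ringChar F ≠ 2) (g : F → ℤ) :
    ∑ x : F, g (x ^ 2) = ∑ X : F, (1 + quadraticChar F X) * g X := by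
  have h1 : ∀ x : F, g (x ^ 2) = ∑ X : F, (if x ^ 2 = X then (1 : ℤ) else 0) * g X := by
    intro x
    simp
  simp_rw [h1]
  rw [Finset.sum_comm]
  refine Finset.sum_congr rfl fun X _ => ?_
  rw [← Finset.sum_mul, sum_sqrt h2]

lemma sum_quad (h2 : ringChar F ≠ 2) (b c : F) :
    ∑ x : F, (if x ^ 2 + b * x + c = 0 then (1 : ℤ) else 0)
      = 1 + quadraticChar F (b ^ 2 - 4 * c) := by
  have h20 : (2 : F) ≠ 0 := Ring.two_ne_zero h2
  have h40 : (4 : F) ≠ 0 := by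
    have : (4 : F) = 2 * 2 := by norm_num
    rw [this]; exact mul_ne_zero h20 h20
  rw [← sum_sqrt h2]
  have hb : Function.Bijective (fun x : F => 2 * x + b) :=
    ((Equiv.mulLeft₀ (2 : F) h20).trans (Equiv.addRight b)).bijective
  refine Fintype.sum_bijective _ hb _ _ fun x => ?_
  have : x ^ 2 + b * x + c = 0 ↔ (2 * x + b) ^ 2 = b ^ 2 - 4 * c := by
    constructor
    · intro h; linear_combination 4 * h
    · intro h
      have : 4 * (x ^ 2 + b * x + c) = 0 := by linear_combination h
      exact (mul_eq_zero.1 this).resolve_left h40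
  simp only [this]

/-- Substitution by scaling. -/
lemma sum_scale (u : F) (hu : u ≠ 0) (g : F → ℤ) : ∑ x : F, g (u * x) = ∑ x : F, g x :=
  Equiv.sum_comp (Equiv.mulLeft₀ u hu) g

lemma chi_sq (u : F) (hu : u ≠ 0) : quadraticChar F u * quadraticChar F u = 1 := by
  rw [← sq]; exact quadraticChar_sq_one hu

/-- Invariance of the character sum under the 2-isogeny. -/
lemma isogeny (h2 : ringChar F ≠ 2) (a b : F) (hb : b ≠ 0) :
    ∑ x : F, quadraticChar F (x * (x ^ 2 + a * x + b))
      = ∑ t : F, quadraticChar F (t * ((t - a) ^ 2 - 4 * b)) := by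
  have key : ∀ t : F, quadraticChar F (t * ((t - a) ^ 2 - 4 * b)) =
      quadraticChar F t * ∑ x : F, (if x ^ 2 + (a - t) * x + b = 0 then (1 : ℤ) else 0)
        - quadraticChar F t := by
    intro t
    rw [sum_quad h2, map_mul]
    have : (a - t) ^ 2 = (t - a) ^ 2 := by ring
    rw [this]; ring
  simp_rw [key]
  rw [Finset.sum_sub_distrib, quadraticChar_sum_zero h2]
  simp_rw [Finset.mul_sum]
  rw [Finset.sum_comm, sub_zero]
  refine Finset.sum_congr rfl fun x _ => ?_
  by_cases hx : x = 0
  · subst hx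
    simp [hb]
  have : ∀ t : F, (x ^ 2 + (a - t) * x + b = 0) ↔ t = (x ^ 2 + a * x + b) / x := by
    intro t
    rw [eq_div_iff hx]
    constructor
    · intro h; linear_combination -h
    · intro h; linear_combination -h
  simp only [this, mul_ite, mul_one, mul_zero, Finset.sum_ite_eq', Finset.mem_univ, if_true]
  have e : x * (x ^ 2 + a * x + b) = x * x * ((x ^ 2 + a * x + b) / x) := by
    field_simp
  rw [e, map_mul, map_mul, chi_sq x hx, one_mul]

end gen

section pp
variable {F : Type*} [Field F] [Fintype F] [DecidableEq F] (p : ℕ) [Fact p.Prime]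

lemma ringChar_ne (hp : p % 4 = 3) [CharP F p] : ringChar F ≠ 2 := by
  rw [ringChar.eq F p]; omega

lemma chi_one (hp : p % 4 = 3) (hF : Fintype.card F = p ^ 2) [CharP F p] (a : F) (ha : a ≠ 0)
    (h : (a ^ 2) ^ p = a ^ 2) : quadraticChar F a = 1 := by
  rw [quadraticChar_one_iff_isSquare ha, FiniteField.isSquare_iff (ringChar_ne p hp) ha, hF]
  have h1 : (a ^ 2) ^ (p - 1) = 1 := by
    have h0 : a ^ 2 ≠ 0 := pow_ne_zero _ ha
    apply mul_right_cancel₀ h0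
    rw [← pow_succ, one_mul, Nat.sub_add_cancel (by omega), h]
  obtain ⟨k, hk⟩ : ∃ k, p = 4 * k + 3 := ⟨p / 4, by omega⟩
  have : p ^ 2 / 2 = 2 * ((p - 1) * (k + 1)) := by
    subst hk
    have : (4 * k + 3) ^ 2 = 2 * (2 * ((4 * k + 2) * (k + 1))) + 1 := by ring
    rw [this]
    have : 4 * k + 3 - 1 = 4 * k + 2 := by omega
    rw [this]; omega
  rw [this, pow_mul, pow_mul, h1, one_pow]

variable [Algebra (ZMod p) F]

lemma alg_pow (a : ZMod p) : (algebraMap (ZMod p) F a) ^ p = algebraMap (ZMod p) F a := by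
  rw [← map_pow, ZMod.pow_card]

lemma alg_inj : Function.Injective (algebraMap (ZMod p) F) := (algebraMap (ZMod p) F).injective

lemma chi_alg (hp : p % 4 = 3) (hF : Fintype.card F = p ^ 2) [CharP F p] (a : ZMod p)
    (ha : a ≠ 0) : quadraticChar F (algebraMap (ZMod p) F a) = 1 := by
  apply chi_one p hp hF
  · simpa using ha
  · rw [← map_pow, alg_pow]

lemma sum_chi_alg (hp : p % 4 = 3) (hF : Fintype.card F = p ^ 2) [CharP F p] :
    ∑ a : ZMod p, quadraticChar F (algebraMap (ZMod p) F a) = p - 1 := by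
  have : ∀ a : ZMod p, quadraticChar F (algebraMap (ZMod p) F a)
      = 1 - (if a = 0 then (1 : ℤ) else 0) := by
    intro a
    split_ifs with h
    · simp [h]
    · rw [chi_alg p hp hF a h]; simp
  simp [this, Finset.sum_sub_distrib, ZMod.card]

lemma B_mem (hp : p % 4 = 3) (hF : Fintype.card F = p ^ 2) [CharP F p] (b : ZMod p) :
    ∑ a : ZMod p, quadraticChar F (algebraMap (ZMod p) F a + algebraMap (ZMod p) F b) = p - 1 := by
  rw [← sum_chi_alg p hp hF, ← Equiv.sum_comp (Equiv.addRight b)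
    (fun a => quadraticChar F (algebraMap (ZMod p) F a))]
  refine Finset.sum_congr rfl fun a _ => ?_
  rw [← map_add, Equiv.coe_addRight]

lemma B_not_mem (hp : p % 4 = 3) (hF : Fintype.card F = p ^ 2) [CharP F p] (u : F)
    (hu : ∀ b, algebraMap (ZMod p) F b ≠ u) :
    ∑ a : ZMod p, quadraticChar F (algebraMap (ZMod p) F a + u) = -1 := by
  have hinj : Function.Injective (fun ab : ZMod p × ZMod p =>
      algebraMap (ZMod p) F ab.2 + algebraMap (ZMod p) F ab.1 * u) := by
    rintro ⟨a, b⟩ ⟨a', b'⟩ h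
    simp only at h
    by_cases haa : a = a'
    · subst haa
      have := alg_inj (F := F) p (add_right_cancel h)
      rw [this]
    · exfalso
      apply hu ((b' - b) / (a - a'))
      have h0 : algebraMap (ZMod p) F a - algebraMap (ZMod p) F a' ≠ 0 := by
        rw [sub_ne_zero]; exact fun h => haa (alg_inj p h)
      rw [map_div₀, map_sub, map_sub, div_eq_iff h0]
      linear_combination -h
  have hbij : Function.Bijective (fun ab : ZMod p × ZMod p =>
      algebraMap (ZMod p) F ab.2 + algebraMap (ZMod p) F ab.1 * u) := by
    rw [Fintype.bijective_iff_injective_and_card]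
    refine ⟨hinj, ?_⟩
    rw [hF, Fintype.card_prod, ZMod.card, sq]
  have h0 := quadraticChar_sum_zero (F := F) (ringChar_ne p hp)
  rw [← hbij.sum_comp, Fintype.sum_prod_type] at h0
  simp only at h0
  set B := ∑ a : ZMod p, quadraticChar F (algebraMap (ZMod p) F a + u) with hB
  have h1 : ∀ b : ZMod p, ∑ a : ZMod p, quadraticChar F
      (algebraMap (ZMod p) F a + algebraMap (ZMod p) F b * u)
        = B + (if b = 0 then (p - 1 - B : ℤ) else 0) := by
    intro b
    split_ifs with hb
    · subst hb
      simp only [map_zero, zero_mul, add_zero]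
      rw [sum_chi_alg p hp hF]; ring
    · rw [add_zero, hB, ← Equiv.sum_comp (Equiv.mulLeft₀ b hb)]
      refine Finset.sum_congr rfl fun a _ => ?_
      have : algebraMap (ZMod p) F (Equiv.mulLeft₀ b hb a) + algebraMap (ZMod p) F b * u
          = algebraMap (ZMod p) F b * (algebraMap (ZMod p) F a + u) := by
        simp; ring
      rw [this, map_mul, chi_alg p hp hF b hb, one_mul]
  simp_rw [h1] at h0
  rw [Finset.sum_add_distrib] at h0
  simp [ZMod.card] at h0
  have hp1 : ((p : ℤ) - 1) ≠ 0 := by omega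
  apply mul_left_cancel₀ hp1
  linear_combination h0

lemma J_alg (hp : p % 4 = 3) (hF : Fintype.card F = p ^ 2) [CharP F p] (a : ZMod p)
    (ha : a ≠ 0) :
    ∑ x : F, quadraticChar F x * quadraticChar F (algebraMap (ZMod p) F a + x ^ 2)
      = ∑ x : F, quadraticChar F x * quadraticChar F (1 + x ^ 2) := by
  have hsq := chi_alg p hp hF (F := F) a ha
  have ha' : algebraMap (ZMod p) F a ≠ 0 := by simpa using ha
  rw [quadraticChar_one_iff_isSquare ha'] at hsq
  obtain ⟨b, hb⟩ := hsq
  have hb0 : b ≠ 0 := by rintro rfl; simp at hb; exact ha hb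
  have hcb : quadraticChar F b = 1 := by
    apply chi_one p hp hF b hb0
    rw [sq, ← hb, alg_pow]
  rw [← sum_scale b hb0]
  refine Finset.sum_congr rfl fun x _ => ?_
  have : algebraMap (ZMod p) F a + (b * x) ^ 2 = b * b * (1 + x ^ 2) := by rw [hb]; ring
  rw [this]
  simp [map_mul, hcb]

lemma J_val (hp : p % 4 = 3) (hF : Fintype.card F = p ^ 2) [CharP F p] :
    ∑ x : F, quadraticChar F x * quadraticChar F (1 + x ^ 2) = 2 * p := by
  have h2 : ringChar F ≠ 2 := ringChar_ne p hp
  set J := ∑ x : F, quadraticChar F x * quadraticChar F (1 + x ^ 2) with hJ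
  have hs0 : ∑ x : F, quadraticChar F x * quadraticChar F (x ^ 2) = 0 := by
    rw [← quadraticChar_sum_zero (F := F) h2]
    refine Finset.sum_congr rfl fun x _ => ?_
    by_cases hx : x = 0
    · simp [hx]
    · rw [quadraticChar_sq_one' hx, mul_one]
  have hT1 : ∑ a : ZMod p, ∑ x : F,
      quadraticChar F x * quadraticChar F (algebraMap (ZMod p) F a + x ^ 2) = (p - 1) * J := by
    have : ∀ a : ZMod p, ∑ x : F,
      quadraticChar F x * quadraticChar F (algebraMap (ZMod p) F a + x ^ 2)
        = J + (if a = 0 then (-J) else 0) := by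
      intro a
      split_ifs with ha
      · subst ha
        simp only [map_zero, zero_add]
        rw [hs0]; ring
      · rw [J_alg p hp hF a ha, add_zero]
    simp_rw [this, Finset.sum_add_distrib]
    simp [ZMod.card]; ring
  have hB : ∀ x : F, ∑ a : ZMod p,
      quadraticChar F x * quadraticChar F (algebraMap (ZMod p) F a + x ^ 2)
      = - quadraticChar F x + p * ∑ a : ZMod p, 
        (if a = 0 then 0 else (if x ^ 2 = algebraMap (ZMod p) F a then (1 : ℤ) else 0)) := by
    intro x
    rw [← Finset.mul_sum]
    by_cases h : ∃ b, algebraMap (ZMod p) F b = x ^ 2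
    · obtain ⟨b, hb⟩ := h
      rw [← hb, B_mem p hp hF]
      have : ∀ a : ZMod p, (if a = 0 then 0 else
          (if algebraMap (ZMod p) F b = algebraMap (ZMod p) F a then (1 : ℤ) else 0))
          = if b = a then (if b = 0 then 0 else 1) else 0 := by
        intro a
        simp only [(alg_inj (F := F) p).eq_iff]
        by_cases h : b = a
        · subst h; simp
        · simp [h]
      simp_rw [this]
      rw [Finset.sum_ite_eq]
      by_cases hx : x = 0
      · subst hx
        have : b = 0 := by simpa using hb
        simp [this]
      · have hb0 : b ≠ 0 := by rintro rfl; simp at hb; exact hx (pow_eq_zero_iff two_ne_zero |>.1 hb.symm)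
        rw [chi_one p hp hF x hx (by rw [← hb, alg_pow])]
        simp [hb0]
        ring
    · push Not at h
      rw [B_not_mem p hp hF _ h]
      have : ∀ a : ZMod p, (if a = 0 then 0 else
          (if x ^ 2 = algebraMap (ZMod p) F a then (1 : ℤ) else 0)) = 0 := by
        intro a
        simp [(h a).symm]
      simp [this]
  rw [Finset.sum_comm] at hT1
  simp_rw [hB] at hT1
  rw [Finset.sum_add_distrib, Finset.sum_neg_distrib, quadraticChar_sum_zero h2,
    ← Finset.mul_sum, Finset.sum_comm] at hT1
  have hc : ∀ a : ZMod p, ∑ x : F, (if a = 0 then 0 else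
      (if x ^ 2 = algebraMap (ZMod p) F a then (1 : ℤ) else 0))
      = 2 - (if a = 0 then 2 else 0) := by
    intro a
    split_ifs with ha
    · simp
    · rw [sum_sqrt h2, chi_alg p hp hF a ha]; norm_num
  simp_rw [hc, Finset.sum_sub_distrib] at hT1
  simp [ZMod.card] at hT1
  have hp1 : ((p : ℤ) - 1) ≠ 0 := by omega
  apply mul_left_cancel₀ hp1
  linear_combination -hT1

end pp

section count
variable {F : Type*} [Field F] [Fintype F] [DecidableEq F]

/-- The conic of squares. -/
def Q (r X Y Z : F) : F := X ^ 2 + Y ^ 2 + Z ^ 2 + r * X * Y - (9 / 4) * Y * Z + r * Z * X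

/-- Its indicator function. -/
def W (r X Y Z : F) : ℤ := if Q r X Y Z = 0 then 1 else 0

lemma W_swap (r X Y Z : F) : W r X Y Z = W r X Z Y := by
  unfold W Q
  congr 2
  ring

lemma W_scale (r X Y Z u : F) (hu : u ≠ 0) : W r (u * X) (u * Y) (u * Z) = W r X Y Z := by
  unfold W
  have : Q r (u * X) (u * Y) (u * Z) = u ^ 2 * Q r X Y Z := by unfold Q; ring
  simp [this, hu]

lemma sum_odd (G : F → F → F → ℤ) (u : F) (hu : u ≠ 0)
    (h : ∀ X Y Z, G (u * X) (u * Y) (u * Z) = - G X Y Z) :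
    ∑ X : F, ∑ Y : F, ∑ Z : F, G X Y Z = 0 := by
  have : ∑ X : F, ∑ Y : F, ∑ Z : F, G X Y Z
      = - ∑ X : F, ∑ Y : F, ∑ Z : F, G X Y Z := by
    conv_lhs =>
      rw [← sum_scale u hu]
      enter [2, X]
      rw [← sum_scale u hu]
      enter [2, Y]
      rw [← sum_scale u hu]
    simp_rw [h, Finset.sum_neg_distrib]
  omega

lemma pair_sum (d : F → F → F) (hd : ∀ u X Y, d (u * X) (u * Y) = u ^ 2 * d X Y) :
    ∑ X : F, ∑ Y : F, quadraticChar F X * quadraticChar F Y * quadraticChar F (d X Y)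
      = (Fintype.card F - 1) * ∑ Y : F, quadraticChar F (Y * d 1 Y) := by
  set S := ∑ Y : F, quadraticChar F (Y * d 1 Y) with hS
  have : ∀ X : F, ∑ Y : F, quadraticChar F X * quadraticChar F Y * quadraticChar F (d X Y)
      = S - (if X = 0 then S else 0) := by
    intro X
    split_ifs with hX
    · simp [hX]
    · rw [sub_zero, hS, ← sum_scale X hX]
      refine Finset.sum_congr rfl fun Y _ => ?_
      have h1 : d X (X * Y) = X ^ 2 * d 1 Y := by rw [← hd, mul_one]
      rw [h1, map_mul, map_mul, map_mul, quadraticChar_sq_one' hX]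
      linear_combination (quadraticChar F Y * quadraticChar F (d 1 Y)) * chi_sq X hX
  simp_rw [this, Finset.sum_sub_distrib]
  simp
  ring

lemma sum_chi_chi (h2 : ringChar F ≠ 2) :
    ∑ X : F, ∑ Y : F, quadraticChar F X * quadraticChar F Y = 0 := by
  simp_rw [← Finset.mul_sum, quadraticChar_sum_zero h2]
  simp

lemma aff_expand (h2 : ringChar F ≠ 2) (r : F) :
    ∑ x : F, ∑ y : F, ∑ z : F, W r (x ^ 2) (y ^ 2) (z ^ 2)
      = ∑ X : F, ∑ Y : F, ∑ Z : F, W r X Y Z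
        + 2 * ∑ X : F, ∑ Y : F, ∑ Z : F, quadraticChar F X * quadraticChar F Y * W r X Y Z
        + ∑ X : F, ∑ Y : F, ∑ Z : F, quadraticChar F Y * quadraticChar F Z * W r X Y Z := by
  obtain ⟨u, hu⟩ := quadraticChar_exists_neg_one (F := F) h2
  have hu0 : u ≠ 0 := by rintro rfl; simp at hu
  have e1 : ∑ x : F, ∑ y : F, ∑ z : F, W r (x ^ 2) (y ^ 2) (z ^ 2)
      = ∑ X : F, ∑ Y : F, ∑ Z : F, (1 + quadraticChar F X) * (1 + quadraticChar F Y)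
        * (1 + quadraticChar F Z) * W r X Y Z := by
    rw [sum_comp_sq h2 (fun X => ∑ y : F, ∑ z : F, W r X (y ^ 2) (z ^ 2))]
    refine Finset.sum_congr rfl fun X _ => ?_
    rw [sum_comp_sq h2 (fun Y => ∑ z : F, W r X Y (z ^ 2)), Finset.mul_sum]
    refine Finset.sum_congr rfl fun Y _ => ?_
    rw [sum_comp_sq h2 (fun Z => W r X Y Z), Finset.mul_sum, Finset.mul_sum]
    refine Finset.sum_congr rfl fun Z _ => ?_
    ring
  have e2 : ∑ X : F, ∑ Y : F, ∑ Z : F, quadraticChar F X * quadraticChar F Y * W r X Y Z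
      = ∑ X : F, ∑ Y : F, ∑ Z : F, quadraticChar F X * quadraticChar F Z * W r X Y Z := by
    refine Finset.sum_congr rfl fun X _ => ?_
    rw [Finset.sum_comm]
    simp_rw [W_swap r X]
  have e3 : ∑ X : F, ∑ Y : F, ∑ Z : F, (quadraticChar F X + quadraticChar F Y + quadraticChar F Z
      + quadraticChar F X * quadraticChar F Y * quadraticChar F Z) * W r X Y Z = 0 := by
    apply sum_odd _ u hu0
    intro X Y Z
    rw [W_scale r X Y Z u hu0]
    simp only [map_mul, hu]
    ring
  rw [e1, two_mul]
  nth_rewrite 2 [e2]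
  rw [← add_zero (∑ X : F, ∑ Y : F, ∑ Z : F, (1 + quadraticChar F X) * (1 + quadraticChar F Y)
        * (1 + quadraticChar F Z) * W r X Y Z), ← neg_zero, ← e3]
  simp only [← Finset.sum_add_distrib, ← Finset.sum_neg_distrib]
  refine Finset.sum_congr rfl fun X _ => Finset.sum_congr rfl fun Y _ =>
    Finset.sum_congr rfl fun Z _ => ?_
  ring

lemma W_sum_Z (h2 : ringChar F ≠ 2) (r X Y : F) :
    ∑ Z : F, W r X Y Z = 1 + quadraticChar F
      ((r * X - 9 / 4 * Y) ^ 2 - 4 * (X ^ 2 + Y ^ 2 + r * X * Y)) := by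
  rw [← sum_quad h2]
  refine Finset.sum_congr rfl fun Z _ => ?_
  unfold W Q
  congr 2
  ring

lemma W_sum_X (h2 : ringChar F ≠ 2) (r Y Z : F) :
    ∑ X : F, W r X Y Z = 1 + quadraticChar F
      ((r * (Y + Z)) ^ 2 - 4 * (Y ^ 2 + Z ^ 2 - 9 / 4 * Y * Z)) := by
  rw [← sum_quad h2]
  refine Finset.sum_congr rfl fun X _ => ?_
  unfold W Q
  congr 2
  ring

variable (p : ℕ) [Fact p.Prime] [Algebra (ZMod p) F]

lemma nat_ne (n : ℕ) (h : ¬ p ∣ n) : (n : ZMod p) ≠ 0 := by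
  rwa [Ne, ZMod.natCast_eq_zero_iff]

lemma two_ne (hp : p % 4 = 3) : (2 : ZMod p) ≠ 0 := by
  have := nat_ne p 2 (fun h => by
    have := Nat.le_of_dvd (by norm_num) h
    interval_cases p <;> omega)
  exact_mod_cast this

lemma seventeen_ne (hp : p % 4 = 3) : (17 : ZMod p) ≠ 0 := by
  have := nat_ne p 17 (fun h => by
    have := (Nat.prime_dvd_prime_iff_eq Fact.out (by norm_num : Nat.Prime 17)).1 h
    omega)
  exact_mod_cast this

lemma discX (h20 : (2 : F) ≠ 0) (c Y Z : F) (hc : c ^ 2 = -2) :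
    ((-(3 / 2) * c) * (Y + Z)) ^ 2 - 4 * (Y ^ 2 + Z ^ 2 - 9 / 4 * Y * Z)
      = -17 / 2 * (Y ^ 2 + Z ^ 2) := by
  have h4 : (4 : F) ≠ 0 := by
    have : (4 : F) = 2 * 2 := by norm_num
    rw [this]; exact mul_ne_zero h20 h20
  have h4' : (4 : F) = 2 * 2 := by norm_num
  rw [h4']
  field_simp
  ring_nf
  rw [hc]
  ring

lemma discZ (h20 : (2 : F) ≠ 0) (c Y : F) (hc : c ^ 2 = -2) :
    ((-(3 / 2) * c) * 1 - 9 / 4 * Y) ^ 2 - 4 * (1 ^ 2 + Y ^ 2 + (-(3 / 2) * c) * 1 * Y)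
      = 17 / 16 * (Y ^ 2 + 12 * c * Y + -8) := by
  have h4 : (4 : F) = 2 * 2 := by norm_num
  have h16 : (16 : F) = 2 * 2 * 2 * 2 := by norm_num
  rw [h4, h16]
  field_simp
  ring_nf
  rw [hc]
  ring

lemma chi_17_16 (hp : p % 4 = 3) (hF : Fintype.card F = p ^ 2) [CharP F p] :
    quadraticChar F (17 / 16) = 1 := by
  have h16 : (16 : ZMod p) ≠ 0 := by
    have : (16 : ZMod p) = 2 ^ 4 := by norm_num
    rw [this]; exact pow_ne_zero _ (two_ne p hp)
  have := chi_alg (F := F) p hp hF (17 / 16) (div_ne_zero (seventeen_ne p hp) h16)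
  simpa only [map_div₀, map_ofNat] using this

lemma chi_17_2 (hp : p % 4 = 3) (hF : Fintype.card F = p ^ 2) [CharP F p] :
    quadraticChar F (-17 / 2) = 1 := by
  have := chi_alg (F := F) p hp hF (-17 / 2)
    (div_ne_zero (neg_ne_zero.2 (seventeen_ne p hp)) (two_ne p hp))
  simpa only [map_div₀, map_neg, map_ofNat] using this

lemma S_YZ (hp : p % 4 = 3) (hF : Fintype.card F = p ^ 2) [CharP F p] (c : F) (hc : c ^ 2 = -2) :
    ∑ X : F, ∑ Y : F, ∑ Z : F, quadraticChar F Y * quadraticChar F Z * W (-(3 / 2) * c) X Y Z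
      = (p ^ 2 - 1) * (2 * p) := by
  have h2 : ringChar F ≠ 2 := ringChar_ne p hp
  have h20 : (2 : F) ≠ 0 := Ring.two_ne_zero h2
  have e : ∑ X : F, ∑ Y : F, ∑ Z : F,
      quadraticChar F Y * quadraticChar F Z * W (-(3 / 2) * c) X Y Z
      = ∑ Y : F, ∑ Z : F, quadraticChar F Y * quadraticChar F Z
        + ∑ Y : F, ∑ Z : F, quadraticChar F Y * quadraticChar F Z
          * quadraticChar F (Y ^ 2 + Z ^ 2) := by
    rw [Finset.sum_comm, ← Finset.sum_add_distrib]
    refine Finset.sum_congr rfl fun Y _ => ?_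
    rw [Finset.sum_comm, ← Finset.sum_add_distrib]
    refine Finset.sum_congr rfl fun Z _ => ?_
    rw [← Finset.mul_sum, W_sum_X h2, discX h20 c Y Z hc, map_mul, chi_17_2 p hp hF]
    ring
  rw [e, sum_chi_chi h2, pair_sum (fun Y Z => Y ^ 2 + Z ^ 2) (by intros; ring), hF,
    ← J_val (F := F) p hp hF]
  simp only [map_mul, one_pow]
  push_cast
  ring

lemma S_XY (hp : p % 4 = 3) (hF : Fintype.card F = p ^ 2) [CharP F p] (c : F) (hc : c ^ 2 = -2) :
    ∑ X : F, ∑ Y : F, ∑ Z : F, quadraticChar F X * quadraticChar F Y * W (-(3 / 2) * c) X Y Z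
      = (p ^ 2 - 1) * (2 * p) := by
  have h2 : ringChar F ≠ 2 := ringChar_ne p hp
  have h20 : (2 : F) ≠ 0 := Ring.two_ne_zero h2
  have h80 : (8 : F) ≠ 0 := by
    have : (8 : F) = 2 ^ 3 := by norm_num
    rw [this]; exact pow_ne_zero _ h20
  have hc0 : c ≠ 0 := by
    rintro rfl
    apply h20
    linear_combination hc
  have h8c0 : 8 * c ≠ 0 := mul_ne_zero h80 hc0
  have h8c : quadraticChar F (8 * c) = 1 := by
    apply chi_one p hp hF _ h8c0
    have : (8 * c) ^ 2 = algebraMap (ZMod p) F (-128) := by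
      rw [map_neg, map_ofNat]
      linear_combination 64 * hc
    rw [this, alg_pow]
  have e : ∑ X : F, ∑ Y : F, ∑ Z : F,
      quadraticChar F X * quadraticChar F Y * W (-(3 / 2) * c) X Y Z
      = ∑ X : F, ∑ Y : F, quadraticChar F X * quadraticChar F Y
        + ∑ X : F, ∑ Y : F, quadraticChar F X * quadraticChar F Y
          * quadraticChar F (((-(3 / 2) * c) * X - 9 / 4 * Y) ^ 2
            - 4 * (X ^ 2 + Y ^ 2 + (-(3 / 2) * c) * X * Y)) := by
    rw [← Finset.sum_add_distrib]
    refine Finset.sum_congr rfl fun X _ => ?_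
    rw [← Finset.sum_add_distrib]
    refine Finset.sum_congr rfl fun Y _ => ?_
    rw [← Finset.mul_sum, W_sum_Z h2]
    ring
  rw [e, sum_chi_chi h2, pair_sum (fun X Y => ((-(3 / 2) * c) * X - 9 / 4 * Y) ^ 2
            - 4 * (X ^ 2 + Y ^ 2 + (-(3 / 2) * c) * X * Y)) (by intros; ring), hF, zero_add]
  have e2 : ∀ Y : F, quadraticChar F (Y * (((-(3 / 2) * c) * 1 - 9 / 4 * Y) ^ 2
      - 4 * (1 ^ 2 + Y ^ 2 + (-(3 / 2) * c) * 1 * Y)))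
      = quadraticChar F (Y * (Y ^ 2 + 12 * c * Y + -8)) := by
    intro Y
    rw [discZ h20 c Y hc, map_mul, map_mul, map_mul, chi_17_16 p hp hF, one_mul]
  simp_rw [e2]
  rw [isogeny h2 _ _ (neg_ne_zero.2 h80), ← sum_scale (8 * c) h8c0,
    ← Equiv.sum_comp (Equiv.addRight (1 : F)), ← J_val (F := F) p hp hF,
    ← J_alg (F := F) p hp hF (-1) (by simp)]
  push_cast
  congr 1
  refine Finset.sum_congr rfl fun v _ => ?_
  rw [Equiv.coe_addRight]
  have : 8 * c * (v + 1) * ((8 * c * (v + 1) - 12 * c) ^ 2 - 4 * -8)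
      = (8 * c) * (8 * c) * (8 * c) * (v * (algebraMap (ZMod p) F (-1) + v ^ 2)) := by
    rw [map_neg, map_one]
    linear_combination (8 * c * (v + 1) * 16) * hc
  rw [this]
  simp only [map_mul] at h8c ⊢
  rw [h8c, map_neg, map_one]
  ring

lemma S_one (hp : p % 4 = 3) (hF : Fintype.card F = p ^ 2) [CharP F p] (c : F) (hc : c ^ 2 = -2) :
    ∑ X : F, ∑ Y : F, ∑ Z : F, W (-(3 / 2) * c) X Y Z = p ^ 4 := by
  have h2 : ringChar F ≠ 2 := ringChar_ne p hp
  have h20 : (2 : F) ≠ 0 := Ring.two_ne_zero h2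
  have e : ∑ X : F, ∑ Y : F, ∑ Z : F, W (-(3 / 2) * c) X Y Z
      = ∑ Y : F, ∑ Z : F, 1
        + ∑ Z : F, ∑ Y : F, quadraticChar F (Y ^ 2 + Z ^ 2) := by
    rw [Finset.sum_comm, Finset.sum_comm (f := fun Z Y => quadraticChar F (Y ^ 2 + Z ^ 2)),
      ← Finset.sum_add_distrib]
    refine Finset.sum_congr rfl fun Y _ => ?_
    rw [Finset.sum_comm, ← Finset.sum_add_distrib]
    refine Finset.sum_congr rfl fun Z _ => ?_
    rw [W_sum_X h2, discX h20 c Y Z hc, map_mul, chi_17_2 p hp hF]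
    ring
  obtain ⟨i, hi⟩ : IsSquare (-1 : F) := by
    rw [← quadraticChar_one_iff_isSquare (by simp)]
    have := chi_alg (F := F) p hp hF (-1) (by simp)
    simpa only [map_neg, map_one] using this
  have hi0 : i ≠ 0 := by
    rintro rfl
    simp at hi
  have hz : ∑ Z : F, ∑ Y : F, quadraticChar F (Y ^ 2 + Z ^ 2) = 0 := by
    have : ∀ Z : F, ∑ Y : F, quadraticChar F (Y ^ 2 + Z ^ 2)
        = ∑ U : F, quadraticChar F U * quadraticChar F (U + 2 * i * Z) := by
      intro Z
      rw [← Equiv.sum_comp (Equiv.addRight (i * Z))]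
      refine Finset.sum_congr rfl fun U _ => ?_
      rw [Equiv.coe_addRight, ← map_mul]
      congr 1
      linear_combination (-Z ^ 2) * hi
    simp_rw [this]
    rw [Finset.sum_comm]
    refine Finset.sum_eq_zero fun U _ => ?_
    have hU : ∑ x : F, quadraticChar F (U + x) = ∑ x : F, quadraticChar F x :=
      Equiv.sum_comp (Equiv.addLeft U) (fun V => quadraticChar F V)
    rw [← Finset.mul_sum, sum_scale (2 * i) (mul_ne_zero h20 hi0)
      (fun V => quadraticChar F (U + V)),
      hU, quadraticChar_sum_zero h2, mul_zero]
  rw [e, hz]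
  simp [hF]
  ring

end count

/-- Affine cone count versus projective count. -/
lemma proj_count {F : Type*} [Field F] [Fintype F] (f : (Fin 3 → F) → Prop)
    (hf : ∀ (u : F) (v : Fin 3 → F), u ≠ 0 → (f (u • v) ↔ f v)) :
    Nat.card {P : Projectivization F (Fin 3 → F) // f P.rep} * (Fintype.card F - 1)
      = Nat.card {v : Fin 3 → F // v ≠ 0 ∧ f v} := by
  classical
  have hu : Nat.card Fˣ = Fintype.card F - 1 := by
    rw [Nat.card_eq_fintype_card, Fintype.card_units]
  rw [← hu, ← Nat.card_prod]
  refine Nat.card_congr (Equiv.ofBijective (fun q => ⟨(q.2 : F) • q.1.1.rep,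
    smul_ne_zero q.2.ne_zero q.1.1.rep_nonzero, (hf _ _ q.2.ne_zero).2 q.1.2⟩) ⟨?_, ?_⟩)
  · rintro ⟨⟨P, hP⟩, u⟩ ⟨⟨P', hP'⟩, u'⟩ h
    have h' : (u : F) • P.rep = (u' : F) • P'.rep := congrArg Subtype.val h
    have hPP : P = P' := by
      rw [← P.mk_rep, ← P'.mk_rep, Projectivization.mk_eq_mk_iff]
      refine ⟨u⁻¹ * u', ?_⟩
      rw [mul_smul, inv_smul_eq_iff]
      exact h'.symm
    subst hPP
    have := smul_left_injective F P.rep_nonzero h'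
    simp [Units.ext this]
  · rintro ⟨v, hv, hfv⟩
    obtain ⟨a, ha⟩ := Projectivization.exists_smul_eq_mk_rep F v hv
    have ha' : (a : F) • v = (Projectivization.mk F v hv).rep := ha
    refine ⟨⟨⟨Projectivization.mk F v hv, ?_⟩, a⁻¹⟩, ?_⟩
    · rw [← ha']; exact (hf _ _ a.ne_zero).2 hfv
    · apply Subtype.ext
      change ((a⁻¹ : Fˣ) : F) • (Projectivization.mk F v hv).rep = v
      rw [← ha', smul_smul]
      simp

end CianiAux

open CianiAux in
/-- Example 4.7 of the paper: for `p ≡ 3 (mod 4)` the Ciani curve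
`x⁴ + y⁴ + z⁴ + (3/√−2) x²y² − (9/4) y²z² + (3/√−2) z²x² = 0` is maximal over
`𝔽_{p²}`, i.e. it has exactly `p² + 6p + 1` points in the projective plane
over the field with `p²` elements. -/
theorem ciani_example_maximal (p : ℕ) [Fact p.Prime] (hp : p % 4 = 3)
    (F : Type*) [Field F] [Fintype F] (hF : Fintype.card F = p ^ 2)
    (c : F) (hc : c ^ 2 = -2) :
    Nat.card {P : Projectivization F (Fin 3 → F) //
        (P.rep 0) ^ 4 + (P.rep 1) ^ 4 + (P.rep 2) ^ 4
          + (3 / c) * (P.rep 0) ^ 2 * (P.rep 1) ^ 2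
          - (9 / 4) * (P.rep 1) ^ 2 * (P.rep 2) ^ 2
          + (3 / c) * (P.rep 2) ^ 2 * (P.rep 0) ^ 2 = 0} =
      p ^ 2 + 6 * p + 1 := by
  classical
  have : CharP F p := charP_of_card_eq_prime_pow hF
  let _ : Algebra (ZMod p) F := ZMod.algebra F p
  have h2 : ringChar F ≠ 2 := ringChar_ne p hp
  have h20 : (2 : F) ≠ 0 := Ring.two_ne_zero h2
  have hc0 : c ≠ 0 := by
    rintro rfl
    apply h20
    linear_combination hc
  have hr : 3 / c = -(3 / 2) * c := by
    field_simp
    linear_combination 3 * hc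
  have hcount := proj_count (F := F) (fun v => v 0 ^ 4 + v 1 ^ 4 + v 2 ^ 4
          + (3 / c) * v 0 ^ 2 * v 1 ^ 2 - (9 / 4) * v 1 ^ 2 * v 2 ^ 2
          + (3 / c) * v 2 ^ 2 * v 0 ^ 2 = 0) (by
    intro u v hu
    simp only [Pi.smul_apply, smul_eq_mul]
    have : (u * v 0) ^ 4 + (u * v 1) ^ 4 + (u * v 2) ^ 4
          + (3 / c) * (u * v 0) ^ 2 * (u * v 1) ^ 2 - (9 / 4) * (u * v 1) ^ 2 * (u * v 2) ^ 2
          + (3 / c) * (u * v 2) ^ 2 * (u * v 0) ^ 2 = u ^ 4 * (v 0 ^ 4 + v 1 ^ 4 + v 2 ^ 4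
          + (3 / c) * v 0 ^ 2 * v 1 ^ 2 - (9 / 4) * v 1 ^ 2 * v 2 ^ 2
          + (3 / c) * v 2 ^ 2 * v 0 ^ 2) := by ring
    rw [this, mul_eq_zero]
    simp [hu])
  set N := Nat.card {P : Projectivization F (Fin 3 → F) //
        (P.rep 0) ^ 4 + (P.rep 1) ^ 4 + (P.rep 2) ^ 4
          + (3 / c) * (P.rep 0) ^ 2 * (P.rep 1) ^ 2
          - (9 / 4) * (P.rep 1) ^ 2 * (P.rep 2) ^ 2
          + (3 / c) * (P.rep 2) ^ 2 * (P.rep 0) ^ 2 = 0} with hN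
  have haff : ((Nat.card {v : Fin 3 → F // v ≠ 0 ∧ v 0 ^ 4 + v 1 ^ 4 + v 2 ^ 4
          + (3 / c) * v 0 ^ 2 * v 1 ^ 2 - (9 / 4) * v 1 ^ 2 * v 2 ^ 2
          + (3 / c) * v 2 ^ 2 * v 0 ^ 2 = 0} : ℕ) : ℤ) + 1
      = ∑ x : F, ∑ y : F, ∑ z : F, W (-(3 / 2) * c) (x ^ 2) (y ^ 2) (z ^ 2) := by
    have h1 : ∑ x : F, ∑ y : F, ∑ z : F, W (-(3 / 2) * c) (x ^ 2) (y ^ 2) (z ^ 2)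
        = ∑ v : Fin 3 → F, W (-(3 / 2) * c) (v 0 ^ 2) (v 1 ^ 2) (v 2 ^ 2) := by
      simp_rw [← Fintype.sum_prod_type']
      let e : (F × F) × F ≃ (Fin 3 → F) :=
        { toFun := fun q => ![q.1.1, q.1.2, q.2]
          invFun := fun v => ((v 0, v 1), v 2)
          left_inv := fun q => by simp
          right_inv := fun v => by ext j; fin_cases j <;> simp }
      rw [← Equiv.sum_comp e]
      simp [e, Fintype.sum_prod_type]
    rw [h1, ← Finset.add_sum_erase _ _ (Finset.mem_univ (0 : Fin 3 → F)), add_comm]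
    congr 1
    · simp [W, Q]
    · rw [Nat.card_eq_fintype_card, Fintype.card_subtype]
      unfold W
      rw [Finset.sum_boole]
      congr 2
      ext v
      simp only [Finset.mem_filter, Finset.mem_univ, true_and, Finset.mem_erase, and_true, hr]
      unfold Q
      refine and_congr_right fun _ => ?_
      ring_nf
  rw [aff_expand h2, S_one p hp hF c hc, S_XY p hp hF c hc, S_YZ p hp hF c hc, ← hcount, hF] at haff
  have hp1 : 1 ≤ p ^ 2 := Nat.one_le_pow _ _ (by omega)
  push_cast [hp1] at haff
  have hne : ((p : ℤ) ^ 2 - 1) ≠ 0 := by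
    have : (3 : ℤ) ≤ p := by omega
    nlinarith
  have : (N : ℤ) = p ^ 2 + 6 * p + 1 := by
    apply mul_right_cancel₀ hne
    linear_combination haff
  exact_mod_cast this
end
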